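/- Let 0 < ε_1 < ε_2 < (r+1)^{r+1}/r^r and let x_{n,1} ≤ … ≤ x_{n,n} denote the zeros of x ↦ F_n(n^r x). Then lim_{n→∞} (1/n) · |{ k ∈ {1,…,n} : ε_1 < x_{n,k} < ε_2 }| = (1/π) f(ρ⁻¹(ε_1)) − (1/π) f(ρ⁻¹(ε_2)). -/

import Mathlib

open Real MeasureTheory Filter Polynomial
open scoped Classical

/-! ### Real-rootedness -/

/-- Hermite–Poulain step: `q - a q'` is real-rooted when `q` is. -/
theorem splits_sub_C_mul_derivative {q : ℝ[X]} (hq : q.Splits) (a : ℝ) :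
    (q - C a * derivative q).Splits := by
  rcases eq_or_ne a 0 with rfl | ha
  · simpa using hq
  refine Splits.of_splits_map Complex.ofRealHom (IsAlgClosed.splits _) fun z hz => ?_
  rw [mem_roots'] at hz
  obtain ⟨hzQ, hz⟩ := hz
  set Q := q.map Complex.ofRealHom with hQ
  have hev : Q.eval z - a * (derivative Q).eval z = 0 := by
    simpa [hQ, IsRoot.def, derivative_map] using hz
  suffices him : z.im = 0 from ⟨z.re, by apply Complex.ext <;> simp [him]⟩
  have hroots : Q.roots = q.roots.map Complex.ofRealHom :=
    hq.roots_map_of_injective Complex.ofRealHom.injective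
  by_contra him
  by_cases h0 : Q.eval z = 0
  · rcases eq_or_ne q 0 with rfl | hq0
    · simp at hzQ
    have hmem : z ∈ Q.roots := by
      rw [mem_roots (by simpa [hQ] using hq0)]
      exact h0
    rw [hroots, Multiset.mem_map] at hmem
    obtain ⟨x, -, rfl⟩ := hmem
    exact him (by simp)
  · have hlog := (hq.map Complex.ofRealHom).eval_derivative_div_eval_of_ne_zero h0
    have hval : (derivative Q).eval z / Q.eval z = ((1 / a : ℝ) : ℂ) := by
      have : (a : ℂ) ≠ 0 := by exact_mod_cast ha
      push_cast
      field_simp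
      linear_combination -hev
    rw [← hQ, hval, hroots, Multiset.map_map] at hlog
    have key : ∀ s : Multiset ℝ,
        ((s.map ((fun w => 1 / (z - w)) ∘ Complex.ofRealHom)).sum).im =
          -z.im * (s.map fun x : ℝ => (Complex.normSq (z - x))⁻¹).sum := by
      intro s
      induction s using Multiset.induction with
      | empty => simp
      | cons x s ih =>
        simp only [Multiset.map_cons, Multiset.sum_cons, Complex.add_im, ih]
        simp [Complex.inv_im]
        ring
    have him0 := congrArg Complex.im hlog
    rw [Complex.ofReal_im, key] at him0
    have hsum : (q.roots.map fun x : ℝ => (Complex.normSq (z - x))⁻¹).sum = 0 := by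
      rcases mul_eq_zero.1 him0.symm with h | h
      · exact absurd (neg_eq_zero.1 h) him
      · exact h
    have hempty : q.roots = 0 := by
      by_contra hne
      obtain ⟨x, hx⟩ := Multiset.exists_mem_of_ne_zero hne
      have hle := Multiset.single_le_sum (s := q.roots.map fun x : ℝ => (Complex.normSq (z - x))⁻¹)
        (by
          intro y hy
          obtain ⟨x, -, rfl⟩ := Multiset.mem_map.1 hy
          exact inv_nonneg.2 (Complex.normSq_nonneg _)) _ (Multiset.mem_map_of_mem _ hx)
      rw [hsum] at hle
      have hpos : 0 < Complex.normSq (z - x) := Complex.normSq_pos.2 fun h => him (by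
        rw [sub_eq_zero.1 h]; simp)
      exact absurd hle (not_le.2 (inv_pos.2 hpos))
    rw [hempty] at hlog
    simp at hlog
    exact ha hlog

/-- The linear map `X ^ k ↦ X ^ (k + m) / (k + m)!`. -/
noncomputable def factorialShift (m : ℕ) : ℝ[X] →ₗ[ℝ] ℝ[X] :=
  Polynomial.lsum fun k => (LinearMap.id : ℝ →ₗ[ℝ] ℝ).smulRight
    (C (((k + m).factorial : ℝ)⁻¹) * X ^ (k + m))

theorem factorialShift_monomial (m k : ℕ) (a : ℝ) :
    factorialShift m (monomial k a) = monomial (k + m) (a / (k + m).factorial) := by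
  rw [factorialShift, Polynomial.lsum_apply, sum_monomial_index _ _ (by simp)]
  simp [div_eq_mul_inv, ← C_mul_X_pow_eq_monomial, smul_eq_C_mul, mul_assoc]

theorem factorialShift_coeff (m : ℕ) (p : ℝ[X]) (k : ℕ) :
    (factorialShift m p).coeff (k + m) = p.coeff k / (k + m).factorial := by
  induction p using Polynomial.induction_on' with
  | add p q hp hq => simp [hp, hq, add_div]
  | monomial n a =>
    rw [factorialShift_monomial, coeff_monomial, coeff_monomial]
    by_cases h : n = k <;> simp [h]

theorem X_pow_dvd_factorialShift (m : ℕ) (p : ℝ[X]) : X ^ m ∣ factorialShift m p := by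
  induction p using Polynomial.induction_on' with
  | add p q hp hq => rw [map_add]; exact dvd_add hp hq
  | monomial n a =>
    rw [factorialShift_monomial, ← C_mul_X_pow_eq_monomial, pow_add]
    exact ⟨C (a / (n + m).factorial) * X ^ n, by ring⟩

theorem factorialShift_X_mul (m : ℕ) (p : ℝ[X]) :
    factorialShift m (X * p) = factorialShift (m + 1) p := by
  induction p using Polynomial.induction_on' with
  | add p q hp hq => rw [mul_add, map_add, map_add, hp, hq]
  | monomial n a =>
    rw [X_mul_monomial, factorialShift_monomial, factorialShift_monomial,
      show n + 1 + m = n + (m + 1) by ring]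

theorem derivative_factorialShift (m : ℕ) (p : ℝ[X]) :
    derivative (factorialShift (m + 1) p) = factorialShift m p := by
  induction p using Polynomial.induction_on' with
  | add p q hp hq => rw [map_add, derivative_add, map_add, hp, hq]
  | monomial n a =>
    rw [factorialShift_monomial, factorialShift_monomial, derivative_monomial,
      show n + (m + 1) - 1 = n + m by omega]
    congr 1
    rw [← add_assoc, Nat.factorial_succ]
    have : ((n + m).factorial : ℝ) ≠ 0 := by positivity
    push_cast
    field_simp

theorem splits_factorialShift {p : ℝ[X]} (hp : p.Splits) (m : ℕ) :
    (factorialShift m p).Splits := by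
  have key : ∀ (s : Multiset ℝ) (m : ℕ),
      (factorialShift m (s.map fun x => X - C x).prod).Splits := by
    intro s
    induction s using Multiset.induction with
    | empty =>
      intro m
      rw [Multiset.map_zero, Multiset.prod_zero, ← monomial_zero_one, factorialShift_monomial]
      exact Splits.monomial _ _
    | cons x s ih =>
      intro m
      rw [Multiset.map_cons, Multiset.prod_cons, sub_mul, map_sub, factorialShift_X_mul,
        ← smul_eq_C_mul, (factorialShift m).map_smul, ← derivative_factorialShift m, smul_eq_C_mul]
      exact splits_sub_C_mul_derivative (ih (m + 1)) x
  rw [hp.eq_prod_roots, ← smul_eq_C_mul, (factorialShift m).map_smul, smul_eq_C_mul]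
  exact (Splits.C _).mul (key _ _)

/-- Dividing the `k`-th coefficient by `(k + m)!` preserves real-rootedness. -/
theorem splits_of_coeff_eq_div_factorial {p q : ℝ[X]} (hp : p.Splits) (m : ℕ)
    (hq : ∀ k, q.coeff k = p.coeff k / (k + m).factorial) : q.Splits := by
  have heq : factorialShift m p = X ^ m * q := by
    obtain ⟨t, ht⟩ := X_pow_dvd_factorialShift m p
    rw [ht]
    congr 1
    ext k
    rw [hq, ← factorialShift_coeff, ht, coeff_X_pow_mul]
  rcases eq_or_ne q 0 with rfl | h0
  · exact Splits.zero
  refine Splits.of_dvd (splits_factorialShift hp m) ?_ (heq ▸ dvd_mul_left _ _)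
  rw [heq]
  exact mul_ne_zero (pow_ne_zero _ X_ne_zero) h0

/-- The polynomials with coefficients `(-1)^k binom(n,k) c^k / ∏ (k + ν_j)!` are real-rooted. -/
theorem splits_of_coeff_eq_choose_div_factorial {ι : Type*} (s : Finset ι) (ν : ι → ℕ) (n : ℕ)
    (c : ℝ) (q : ℝ[X])
    (hq : ∀ k, q.coeff k = (-1) ^ k * (n.choose k) * c ^ k / ∏ j ∈ s, ((k + ν j).factorial : ℝ)) :
    q.Splits := by
  induction s using Finset.induction generalizing q with
  | empty =>
    have : q = (C (-c) * X + C 1) ^ n := by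
      ext k
      rw [hq, add_pow, finsetSum_coeff]
      simp only [mul_pow, ← C_pow, one_pow, mul_one, ← C_eq_natCast, C_1]
      simp only [mul_assoc, mul_comm _ (C _), coeff_C_mul, coeff_X_pow]
      by_cases hk : k < n + 1
      · rw [Finset.sum_eq_single k]
        · rw [neg_pow c]; simp; ring
        · intro b _ hb; simp [Ne.symm hb]
        · intro h; simp at h; omega
      · rw [Finset.sum_eq_zero]
        · simp [Nat.choose_eq_zero_of_lt (show n < k by omega)]
        · intro b hb
          have : k ≠ b := by simp at hb; omega
          simp [this]
    rw [this]
    exact (Splits.of_natDegree_le_one natDegree_linear_le).pow n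
  | insert i s hi ih =>
    let p : ℝ[X] := ∑ k ∈ Finset.range (n + 1), monomial k ((-1) ^ k * (n.choose k) * c ^ k /
      ∏ j ∈ s, ((k + ν j).factorial : ℝ))
    have hp : ∀ k, p.coeff k = (-1) ^ k * (n.choose k) * c ^ k /
        ∏ j ∈ s, ((k + ν j).factorial : ℝ) := by
      intro k
      simp only [p, finsetSum_coeff, coeff_monomial, Finset.sum_ite_eq', Finset.mem_range]
      split_ifs with h
      · rfl
      · simp [Nat.choose_eq_zero_of_lt (show n < k by omega)]
    refine splits_of_coeff_eq_div_factorial (ih p hp) (ν i) fun k => ?_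
    rw [hq, hp, Finset.prod_insert hi]
    field_simp

/-! ### The logarithmic derivative as a generating function of power sums -/

section PowerSums

open PowerSeries (constantCoeff)

/-- Generating function of the power sums of a multiset. -/
noncomputable def powerSumSeries (s : Multiset ℝ) : PowerSeries ℝ :=
  PowerSeries.mk fun k => (s.map (· ^ k)).sum

/-- The Euler derivation `X d/dX` on power series. -/
noncomputable def euler (U : PowerSeries ℝ) : PowerSeries ℝ :=
  PowerSeries.X * PowerSeries.derivative ℝ U

theorem coeff_euler (U : PowerSeries ℝ) (j : ℕ) :
    PowerSeries.coeff j (euler U) = j * PowerSeries.coeff j U := by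
  cases j with
  | zero => simp [euler]
  | succ j =>
    rw [euler, PowerSeries.coeff_succ_X_mul, PowerSeries.coeff_derivative]
    push_cast
    ring

theorem euler_mul (U V : PowerSeries ℝ) : euler (U * V) = euler U * V + U * euler V := by
  simp only [euler, Derivation.leibniz, smul_eq_mul]
  ring

theorem euler_one_sub_C_mul_X (x : ℝ) :
    euler (1 - PowerSeries.C x * PowerSeries.X) = -(PowerSeries.C x * PowerSeries.X) := by
  ext j
  rw [coeff_euler]
  rcases j with _ | _ | j <;> simp [PowerSeries.coeff_one]

theorem mk_pow_mul_one_sub (x : ℝ) :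
    PowerSeries.mk (fun k => x ^ k) * (1 - PowerSeries.C x * PowerSeries.X) = 1 := by
  ext j
  rw [mul_sub, mul_one, ← mul_assoc, mul_comm _ (PowerSeries.C x), mul_assoc]
  cases j with
  | zero => simp
  | succ j => simp [PowerSeries.coeff_succ_mul_X, PowerSeries.coeff_one, pow_succ']

theorem powerSumSeries_cons (x : ℝ) (s : Multiset ℝ) :
    powerSumSeries (x ::ₘ s) = PowerSeries.mk (fun k => x ^ k) + powerSumSeries s := by
  ext j
  simp [powerSumSeries]

theorem powerSumSeries_mul_prod (s : Multiset ℝ) :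
    powerSumSeries s * (s.map fun x => 1 - PowerSeries.C x * PowerSeries.X).prod =
      (s.card : PowerSeries ℝ) * (s.map fun x => 1 - PowerSeries.C x * PowerSeries.X).prod -
        euler (s.map fun x => 1 - PowerSeries.C x * PowerSeries.X).prod := by
  induction s using Multiset.induction with
  | empty =>
    ext j
    simp [powerSumSeries, euler]
  | cons x s ih =>
    rw [Multiset.map_cons, Multiset.prod_cons, powerSumSeries_cons, euler_mul,
      euler_one_sub_C_mul_X, Multiset.card_cons]
    push_cast
    linear_combination (1 - PowerSeries.C x * PowerSeries.X) * ih +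
      (s.map fun x => 1 - PowerSeries.C x * PowerSeries.X).prod * mk_pow_mul_one_sub x

theorem reverse_X_sub_C_eq (x : ℝ) : (X - C x : ℝ[X]).reverse = 1 - C x * X := by
  ext j
  rw [coeff_reverse, natDegree_X_sub_C]
  rcases j with _ | _ | j
  · rw [revAt_le zero_le_one]
    simp [coeff_C]
  · rw [revAt_le le_rfl]
    simp [coeff_one, coeff_X]
  · rw [revAt_eq_self_of_lt (by omega)]
    simp [coeff_one, coeff_X]

theorem coe_reverse_eq_of_splits {G : ℝ[X]} (hG : G.Splits) :
    (G.reverse : PowerSeries ℝ) = PowerSeries.C G.leadingCoeff *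
      (G.roots.map fun x => 1 - PowerSeries.C x * PowerSeries.X).prod := by
  have key : ∀ s : Multiset ℝ, (((s.map fun x => X - C x).prod.reverse : ℝ[X]) : PowerSeries ℝ) =
      (s.map fun x => 1 - PowerSeries.C x * PowerSeries.X).prod := by
    intro s
    induction s using Multiset.induction with
    | empty =>
      rw [Multiset.map_zero, Multiset.prod_zero, ← C_1, reverse_C]
      simp
    | cons x s ih =>
      rw [Multiset.map_cons, Multiset.prod_cons, reverse_mul_of_domain, Polynomial.coe_mul, ih,
        reverse_X_sub_C_eq]
      simp
  conv_lhs => rw [hG.eq_prod_roots]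
  rw [reverse_mul_of_domain, reverse_C, Polynomial.coe_mul, key, Polynomial.coe_C]

theorem powerSumSeries_roots_mul_reverse {G : ℝ[X]} (hG : G.Splits) :
    powerSumSeries G.roots * (G.reverse : PowerSeries ℝ) =
      (G.natDegree : PowerSeries ℝ) * (G.reverse : PowerSeries ℝ) -
        euler (G.reverse : PowerSeries ℝ) := by
  have hC : euler (PowerSeries.C G.leadingCoeff) = 0 := by simp [euler]
  rw [coe_reverse_eq_of_splits hG, euler_mul, hC, ← splits_iff_card_roots.1 hG]
  linear_combination PowerSeries.C G.leadingCoeff * powerSumSeries_mul_prod G.roots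

/-- Starting from `W`, successively apply `U ↦ W U + (ν U - X U') / n` for the `ν` in a list. -/
noncomputable def riccatiIterate (n : ℕ) (W : PowerSeries ℝ) : List ℕ → PowerSeries ℝ
  | [] => W
  | ν :: l => W * riccatiIterate n W l + PowerSeries.C ((n : ℝ)⁻¹) *
      (PowerSeries.C (ν : ℝ) * riccatiIterate n W l - euler (riccatiIterate n W l))

theorem coeff_riccatiIterate_mul {n : ℕ} (hn : n ≠ 0) {W Q : PowerSeries ℝ}
    (hWQ : W * Q = Q - PowerSeries.C ((n : ℝ)⁻¹) * euler Q) (l : List ℕ) (j : ℕ) :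
    PowerSeries.coeff j (riccatiIterate n W l * Q) = ((n : ℝ)⁻¹) ^ (l.length + 1) * ((n : ℝ) - j) *
      (l.map fun ν : ℕ => (n : ℝ) - j + ν).prod * PowerSeries.coeff j Q := by
  have hn' : (n : ℝ) ≠ 0 := by exact_mod_cast hn
  induction l generalizing j with
  | nil =>
    rw [riccatiIterate, hWQ, map_sub, PowerSeries.coeff_C_mul, coeff_euler]
    simp
    field_simp
  | cons ν l ih =>
    have hstep : riccatiIterate n W (ν :: l) * Q = riccatiIterate n W l * Q +
        PowerSeries.C ((n : ℝ)⁻¹) * (PowerSeries.C (ν : ℝ) * (riccatiIterate n W l * Q) -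
          euler (riccatiIterate n W l * Q)) := by
      rw [riccatiIterate, euler_mul]
      linear_combination riccatiIterate n W l * hWQ
    rw [hstep, map_add, PowerSeries.coeff_C_mul, map_sub, PowerSeries.coeff_C_mul, coeff_euler, ih]
    simp only [List.length_cons, List.map_cons, List.prod_cons]
    linear_combination -((n : ℝ)⁻¹ ^ (l.length + 1) * ((n : ℝ) - j) *
      (l.map fun ν : ℕ => (n : ℝ) - j + ν).prod * PowerSeries.coeff j Q) *
        inv_mul_cancel₀ hn'

/-- The hypergeometric recurrence of the coefficients turns into a Riccati-type equation for the
generating function of the mean power sums of the roots. -/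
theorem riccati_equation {n : ℕ} (hn : n ≠ 0) {G : ℝ[X]} (hG : G.Splits) (hdeg : G.natDegree = n)
    (l : List ℕ)
    (hrec : ∀ k < n, ((k : ℝ) + 1) * (l.map fun ν : ℕ => (k : ℝ) + 1 + ν).prod * G.coeff (k + 1) =
      (n : ℝ) ^ l.length * ((k : ℝ) - n) * G.coeff k) :
    PowerSeries.C ((n : ℝ)⁻¹) * powerSumSeries G.roots = 1 + PowerSeries.X *
      riccatiIterate n (PowerSeries.C ((n : ℝ)⁻¹) * powerSumSeries G.roots) l := by
  have hn' : (n : ℝ) ≠ 0 := by exact_mod_cast hn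
  set W := PowerSeries.C ((n : ℝ)⁻¹) * powerSumSeries G.roots with hW
  set Q := (G.reverse : PowerSeries ℝ) with hQ
  have hG0 : G ≠ 0 := by rintro rfl; simp at hdeg; omega
  have hQ0 : Q ≠ 0 := by simpa [hQ] using hG0
  have hCn : PowerSeries.C ((n : ℝ)⁻¹) * (n : PowerSeries ℝ) = 1 := by
    rw [← map_natCast (PowerSeries.C (R := ℝ)) n, ← map_mul, inv_mul_cancel₀ hn', map_one]
  have hWQ : W * Q = Q - PowerSeries.C ((n : ℝ)⁻¹) * euler Q := by
    have h := powerSumSeries_roots_mul_reverse hG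
    rw [hdeg] at h
    linear_combination PowerSeries.C ((n : ℝ)⁻¹) * h + Q * hCn
  have hlow : ∀ j ≤ n, PowerSeries.coeff j Q = G.coeff (n - j) := by
    intro j hj
    rw [hQ, Polynomial.coeff_coe, coeff_reverse, hdeg, revAt_le hj]
  have hhigh : ∀ j, n < j → PowerSeries.coeff j Q = 0 := by
    intro j hj
    rw [hQ, Polynomial.coeff_coe]
    exact coeff_eq_zero_of_natDegree_lt
      (lt_of_le_of_lt (reverse_natDegree_le G) (by omega))
  apply mul_right_cancel₀ hQ0
  rw [add_mul, one_mul, hWQ, mul_assoc]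
  ext j
  rw [map_sub, PowerSeries.coeff_C_mul, coeff_euler, map_add]
  cases j with
  | zero => simp
  | succ j =>
    rw [PowerSeries.coeff_succ_X_mul, coeff_riccatiIterate_mul hn hWQ]
    rcases lt_trichotomy j n with hj | rfl | hj
    · rw [hlow j hj.le, hlow (j + 1) hj]
      obtain ⟨k, rfl⟩ : ∃ k, n = k + 1 + j := ⟨n - j - 1, by omega⟩
      have h := hrec k (by omega)
      rw [show k + 1 + j - (j + 1) = k by omega, show k + 1 + j - j = k + 1 by omega]
      have e : (((k + 1 + j : ℕ) : ℝ) - j) = (k : ℝ) + 1 := by push_cast; ring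
      simp only [e]
      have h' : ((k + 1 + j : ℕ) : ℝ)⁻¹ ^ (l.length + 1) * ((k + 1 + j : ℕ) : ℝ) ^ l.length =
          ((k + 1 + j : ℕ) : ℝ)⁻¹ := by
        rw [pow_succ', mul_assoc, ← mul_pow, inv_mul_cancel₀ hn', one_pow, mul_one]
      have e' : ((k : ℝ) - (k + 1 + j : ℕ)) = -((j + 1 : ℕ) : ℝ) := by push_cast; ring
      rw [e'] at h
      linear_combination -((k + 1 + j : ℕ) : ℝ)⁻¹ ^ (l.length + 1) * h +
        ((j + 1 : ℕ) : ℝ) * G.coeff k * h'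
    · simp [hhigh (j + 1) (by omega)]
    · simp [hhigh j hj, hhigh (j + 1) (by omega)]

/-! ### Coefficientwise limits -/

theorem tendsto_coeff_mul {k : ℕ} {U V : ℕ → PowerSeries ℝ} {L M : PowerSeries ℝ}
    (hU : ∀ j < k, Tendsto (fun n => PowerSeries.coeff j (U n)) atTop
      (nhds (PowerSeries.coeff j L)))
    (hV : ∀ j < k, Tendsto (fun n => PowerSeries.coeff j (V n)) atTop
      (nhds (PowerSeries.coeff j M))) :
    ∀ j < k, Tendsto (fun n => PowerSeries.coeff j (U n * V n)) atTop
      (nhds (PowerSeries.coeff j (L * M))) := by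
  intro j hj
  simp only [PowerSeries.coeff_mul]
  refine tendsto_finsetSum _ fun p hp => ?_
  have := Finset.HasAntidiagonal.mem_antidiagonal.1 hp
  exact (hU _ (by omega)).mul (hV _ (by omega))

theorem tendsto_coeff_riccatiIterate {k : ℕ} {W : ℕ → PowerSeries ℝ} {B : PowerSeries ℝ}
    (hW : ∀ j < k, Tendsto (fun n => PowerSeries.coeff j (W n)) atTop
      (nhds (PowerSeries.coeff j B))) (l : List ℕ) :
    ∀ j < k, Tendsto (fun n => PowerSeries.coeff j (riccatiIterate n (W n) l)) atTop
      (nhds (PowerSeries.coeff j (B ^ (l.length + 1)))) := by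
  induction l with
  | nil => simpa [riccatiIterate] using hW
  | cons ν l ih =>
    intro j hj
    have h1 := tendsto_coeff_mul hW ih j hj
    have h2 : Tendsto (fun n : ℕ => (n : ℝ)⁻¹ *
        ((ν : ℝ) * PowerSeries.coeff j (riccatiIterate n (W n) l) -
        j * PowerSeries.coeff j (riccatiIterate n (W n) l))) atTop (nhds 0) := by
      have := (tendsto_inv_atTop_zero.comp (tendsto_natCast_atTop_atTop (R := ℝ))).mul
        (((ih j hj).const_mul (ν : ℝ)).sub ((ih j hj).const_mul (j : ℝ)))
      simpa using this
    have h3 := h1.add h2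
    rw [add_zero, ← pow_succ'] at h3
    simpa only [riccatiIterate, map_add, map_sub, PowerSeries.coeff_C_mul, coeff_euler,
      List.length_cons] using h3

theorem tendsto_coeff_of_riccati {W : ℕ → PowerSeries ℝ} (l : List ℕ) {B : PowerSeries ℝ}
    (hB : B = 1 + PowerSeries.X * B ^ (l.length + 1))
    (hW : ∀ n ≠ 0, W n = 1 + PowerSeries.X * riccatiIterate n (W n) l) (j : ℕ) :
    Tendsto (fun n => PowerSeries.coeff j (W n)) atTop (nhds (PowerSeries.coeff j B)) := by
  suffices h : ∀ k, ∀ j < k, Tendsto (fun n => PowerSeries.coeff j (W n)) atTop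
      (nhds (PowerSeries.coeff j B)) from
    h (j + 1) j (Nat.lt_succ_self j)
  intro k
  induction k with
  | zero => intro j hj; omega
  | succ k ih =>
    intro j hj
    have hev : (fun n => PowerSeries.coeff j (1 + PowerSeries.X * riccatiIterate n (W n) l)) =ᶠ[atTop]
        fun n => PowerSeries.coeff j (W n) := by
      filter_upwards [eventually_ne_atTop 0] with n hn
      rw [← hW n hn]
    refine Tendsto.congr' hev ?_
    rw [hB]
    cases j with
    | zero => simp
    | succ j =>
      simp only [map_add, PowerSeries.coeff_succ_X_mul]
      exact (tendsto_coeff_riccatiIterate ih l j (by omega)).const_add _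

/-! ### The Fuss–Catalan series -/

/-- A map on power series that contracts in the `X`-adic sense has a fixed point. -/
theorem exists_fixedPoint_of_contracting (Φ : PowerSeries ℝ → PowerSeries ℝ)
    (hΦ : ∀ m U V, PowerSeries.X ^ m ∣ U - V → PowerSeries.X ^ (m + 1) ∣ Φ U - Φ V) :
    ∃ B, B = Φ B := by
  have hstep : ∀ m, PowerSeries.X ^ m ∣ Φ^[m + 1] 0 - Φ^[m] 0 := by
    intro m
    induction m with
    | zero => simp
    | succ m ih =>
      rw [Function.iterate_succ_apply', Function.iterate_succ_apply' Φ m]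
      exact hΦ _ _ _ (by simpa only [Function.iterate_succ_apply'] using ih)
  have hstab : ∀ m i, PowerSeries.X ^ m ∣ Φ^[m + i] 0 - Φ^[m] 0 := by
    intro m i
    induction i with
    | zero => simp
    | succ i ih =>
      have h := (pow_dvd_pow _ (Nat.le_add_right m i)).trans (hstep (m + i))
      have := dvd_add h ih
      rwa [sub_add_sub_cancel] at this
  let B : PowerSeries ℝ := PowerSeries.mk fun k => PowerSeries.coeff k (Φ^[k + 1] 0)
  have hB : ∀ m, PowerSeries.X ^ m ∣ B - Φ^[m] 0 := by
    intro m
    rw [PowerSeries.X_pow_dvd_iff]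
    intro k hk
    obtain ⟨i, rfl⟩ := Nat.exists_eq_add_of_le (Nat.succ_le_of_lt hk)
    have := PowerSeries.X_pow_dvd_iff.1 (hstab (k + 1) i) k (Nat.lt_succ_self k)
    rw [map_sub, sub_eq_zero] at this ⊢
    rw [PowerSeries.coeff_mk, ← this]
  refine ⟨B, ?_⟩
  ext k
  have h := dvd_sub (hB (k + 1)) (by
    rw [Function.iterate_succ_apply']
    exact hΦ k _ _ (hB k) : PowerSeries.X ^ (k + 1) ∣ Φ B - Φ^[k + 1] 0)
  rw [sub_sub_sub_cancel_right] at h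
  have := PowerSeries.X_pow_dvd_iff.1 h k (Nat.lt_succ_self k)
  rwa [map_sub, sub_eq_zero] at this

theorem exists_fussCatalan_series (r : ℕ) :
    ∃ B : PowerSeries ℝ, B = 1 + PowerSeries.X * B ^ (r + 1) := by
  refine exists_fixedPoint_of_contracting (fun U => 1 + PowerSeries.X * U ^ (r + 1)) ?_
  intro m U V h
  rw [add_sub_add_left_eq_sub, ← mul_sub, pow_succ']
  exact mul_dvd_mul_left _ (h.trans (sub_dvd_pow_sub_pow U V _))

/-- Residue computation behind Lagrange inversion: `res (u' / u ^ m) = δ_{m, 1}` for `u = X v`. -/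
theorem coeff_inv_pow_mul_derivative {v : PowerSeries ℝ} (hv : constantCoeff v = 1) (m : ℕ) :
    PowerSeries.coeff m (v⁻¹ ^ (m + 1) * PowerSeries.derivative ℝ (PowerSeries.X * v)) =
      if m = 0 then 1 else 0 := by
  have hvi : v⁻¹ * v = 1 := PowerSeries.inv_mul_cancel v (by simp [hv])
  have hd : PowerSeries.derivative ℝ (PowerSeries.X * v) = v + euler v := by
    rw [Derivation.leibniz, PowerSeries.derivative_X, euler, smul_eq_mul, smul_eq_mul]
    ring
  have hinv : euler v⁻¹ = -(v⁻¹ ^ 2 * euler v) := by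
    rw [euler, PowerSeries.derivative_inv', euler]
    ring
  have hpow : ∀ m : ℕ, euler (v⁻¹ ^ m) = -((m : PowerSeries ℝ) * v⁻¹ ^ (m + 1) * euler v) := by
    intro m
    induction m with
    | zero => simp [euler]
    | succ m ih =>
      rw [pow_succ, euler_mul, ih, hinv]
      push_cast
      ring
  rcases eq_or_ne m 0 with rfl | hm
  · simp [hd, euler, hv]
  have hm' : (m : ℝ) ≠ 0 := by exact_mod_cast hm
  rw [if_neg hm]
  apply (mul_eq_zero.1 _).resolve_left hm'
  have hcalc : (m : PowerSeries ℝ) * (v⁻¹ ^ (m + 1) *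
      PowerSeries.derivative ℝ (PowerSeries.X * v)) =
      (m : PowerSeries ℝ) * v⁻¹ ^ m - euler (v⁻¹ ^ m) := by
    rw [hpow, hd]
    linear_combination (m : PowerSeries ℝ) * v⁻¹ ^ m * hvi
  have hcast : (m : PowerSeries ℝ) = PowerSeries.C (m : ℝ) := by simp
  rw [← PowerSeries.coeff_C_mul, ← hcast, hcalc, map_sub, coeff_euler, hcast,
    PowerSeries.coeff_C_mul, sub_self]

theorem coeff_fussCatalan_series {r : ℕ} {B : PowerSeries ℝ}
    (hB : B = 1 + PowerSeries.X * B ^ (r + 1)) (k : ℕ) :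
    ((k : ℝ) + 1) * PowerSeries.coeff (k + 1) B = ((r + 1) * (k + 1)).choose k := by
  have hB0 : constantCoeff B = 1 := by rw [hB]; simp
  set v := B ^ (r + 1) with hv
  have hv0 : constantCoeff v = 1 := by simp [hv, hB0]
  have hvi : v⁻¹ * v = 1 := PowerSeries.inv_mul_cancel v (by simp [hv0])
  have hder : PowerSeries.derivative ℝ B = PowerSeries.derivative ℝ (PowerSeries.X * v) := by
    conv_lhs => rw [hB]
    simp
  have hexp : PowerSeries.derivative ℝ B = ∑ j ∈ Finset.range ((r + 1) * (k + 1) + 1),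
      PowerSeries.C (((r + 1) * (k + 1)).choose j : ℝ) * (PowerSeries.X ^ j *
        (v ^ j * v⁻¹ ^ (k + 1) * PowerSeries.derivative ℝ (PowerSeries.X * v))) := by
    have h1 : v ^ (k + 1) = ∑ j ∈ Finset.range ((r + 1) * (k + 1) + 1),
        (PowerSeries.X * v) ^ j * (((r + 1) * (k + 1)).choose j : PowerSeries ℝ) := by
      rw [hv, ← pow_mul, ← hv]
      conv_lhs => rw [hB, add_comm, add_pow]
      simp
    calc PowerSeries.derivative ℝ B
        = v ^ (k + 1) * (v⁻¹ ^ (k + 1) * PowerSeries.derivative ℝ (PowerSeries.X * v)) := by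
          rw [← mul_assoc, ← mul_pow, mul_comm v, hvi, one_pow, one_mul, hder]
      _ = _ := by
          rw [h1, Finset.sum_mul]
          refine Finset.sum_congr rfl fun j _ => ?_
          rw [map_natCast]
          ring
  have hc := congrArg (PowerSeries.coeff k) hexp
  rw [PowerSeries.coeff_derivative, map_sum] at hc
  rw [mul_comm, hc, Finset.sum_eq_single k]
  · have h := coeff_inv_pow_mul_derivative hv0 0
    rw [PowerSeries.coeff_C_mul, pow_succ, ← mul_assoc (v ^ k), ← mul_pow, mul_comm v, hvi,
      one_pow, one_mul, PowerSeries.coeff_X_pow_mul', if_pos le_rfl, Nat.sub_self]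
    rw [zero_add, pow_one, if_pos rfl] at h
    rw [h, mul_one]
  · intro j _ hj
    rw [PowerSeries.coeff_C_mul, PowerSeries.coeff_X_pow_mul']
    split_ifs with hjk
    · obtain ⟨m, rfl⟩ := Nat.exists_eq_add_of_le hjk
      have h := coeff_inv_pow_mul_derivative hv0 m
      rw [if_neg (by omega)] at h
      rw [show j + m + 1 = j + (m + 1) by ring, pow_add, ← mul_assoc (v ^ j), ← mul_pow,
        mul_comm v, hvi, one_pow, one_mul, Nat.add_sub_cancel_left, h, mul_zero]
    · simp
  · intro h
    exfalso
    apply h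
    rw [Finset.mem_range]
    nlinarith [Nat.zero_le (r * (k + 1))]

end PowerSums

/-! ### The method of moments -/

theorem integrable_eval_of_integrable_pow {μ : Measure ℝ}
    (h : ∀ k : ℕ, Integrable (fun x : ℝ => x ^ k) μ) (P : ℝ[X]) :
    Integrable (fun x => P.eval x) μ := by
  simp only [eval_eq_sum_range]
  exact integrable_finsetSum _ fun i _ => (h i).const_mul _

theorem integral_eval_eq_sum_moments {μ : Measure ℝ}
    (h : ∀ k : ℕ, Integrable (fun x : ℝ => x ^ k) μ) (P : ℝ[X]) :
    ∫ x, P.eval x ∂μ = ∑ i ∈ Finset.range (P.natDegree + 1), P.coeff i * ∫ x, x ^ i ∂μ := by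
  simp only [eval_eq_sum_range]
  rw [integral_finsetSum _ fun i _ => (h i).const_mul _]
  simp only [integral_const_mul]

theorem abs_eval_le_sum_abs_mul_pow (P : ℝ[X]) {x : ℝ} (hx : 1 ≤ |x|) :
    |P.eval x| ≤ (∑ i ∈ Finset.range (P.natDegree + 1), |P.coeff i|) * |x| ^ P.natDegree := by
  rw [eval_eq_sum_range, Finset.sum_mul]
  refine (Finset.abs_sum_le_sum_abs _ _).trans (Finset.sum_le_sum fun i hi => ?_)
  rw [abs_mul, abs_pow]
  have : i ≤ P.natDegree := Nat.lt_succ_iff.1 (Finset.mem_range.1 hi)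
  gcongr

/-- Method of moments: convergence of all moments to those of a compactly supported probability
measure implies weak convergence. -/
theorem tendsto_probabilityMeasure_of_moments {μs : ℕ → ProbabilityMeasure ℝ}
    {μ : ProbabilityMeasure ℝ} {c : ℝ} (hc : ∀ᵐ x ∂(μ : Measure ℝ), |x| ≤ c)
    (hint : ∀ n (k : ℕ), Integrable (fun x : ℝ => x ^ k) (μs n : Measure ℝ))
    (hmom : ∀ k : ℕ, Tendsto (fun n => ∫ x, x ^ k ∂(μs n : Measure ℝ)) atTop
      (nhds (∫ x, x ^ k ∂(μ : Measure ℝ)))) :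
    Tendsto μs atTop (nhds μ) := by
  have hc0 : 0 ≤ c := by
    obtain ⟨x, hx⟩ := hc.exists
    exact (abs_nonneg x).trans hx
  have hintμ : ∀ k : ℕ, Integrable (fun x : ℝ => x ^ k) (μ : Measure ℝ) := fun k =>
    Integrable.of_bound (by fun_prop) (c ^ k) (by
      filter_upwards [hc] with x hx
      rw [norm_pow]
      exact pow_le_pow_left₀ (norm_nonneg _) hx k)
  have hpoly : ∀ P : ℝ[X], Tendsto (fun n => ∫ x, P.eval x ∂(μs n : Measure ℝ)) atTop
      (nhds (∫ x, P.eval x ∂(μ : Measure ℝ))) := by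
    intro P
    simp only [integral_eval_eq_sum_moments hintμ, fun n => integral_eval_eq_sum_moments (hint n)]
    exact tendsto_finsetSum _ fun i _ => (hmom i).const_mul _
  rw [ProbabilityMeasure.tendsto_iff_forall_integral_tendsto]
  intro g
  rw [Metric.tendsto_atTop]
  intro ε hε
  set δ := ε / 5 with hδ
  have hδ0 : 0 < δ := by positivity
  set R := c + 1 with hR
  have hR1 : 1 ≤ R := by linarith
  obtain ⟨P, hP⟩ := exists_polynomial_near_of_continuousOn (-R) R g g.continuous.continuousOn δ hδ0
  set K := ‖g‖ + ∑ i ∈ Finset.range (P.natDegree + 1), |P.coeff i| with hK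
  have hK0 : 0 ≤ K := add_nonneg (norm_nonneg _) (Finset.sum_nonneg fun i _ => abs_nonneg _)
  set d := P.natDegree with hd
  obtain ⟨i, hi⟩ : ∃ i : ℕ, K * c ^ (2 * d) * (c / R) ^ (2 * i) < δ := by
    have hq : (c / R) ^ 2 < 1 := by
      have : c / R < 1 := (div_lt_one (by linarith)).2 (by linarith)
      exact pow_lt_one₀ (by positivity) this two_ne_zero
    have := (tendsto_pow_atTop_nhds_zero_of_lt_one (by positivity) hq).const_mul
      (K * c ^ (2 * d))
    rw [mul_zero] at this
    obtain ⟨i, hi⟩ := (this.eventually (gt_mem_nhds hδ0)).exists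
    exact ⟨i, by rwa [pow_mul (c / R)]⟩
  set H : ℝ[X] := C δ + C (K / R ^ (2 * i)) * X ^ (2 * (d + i)) with hH
  have hHev : ∀ x, H.eval x = δ + K / R ^ (2 * i) * x ^ (2 * (d + i)) := by intro x; simp [hH]
  have hbound : ∀ x, |g x - P.eval x| ≤ H.eval x := by
    intro x
    rw [hHev]
    by_cases hx : |x| ≤ R
    · have h1 := hP x (abs_le.1 hx)
      rw [abs_sub_comm] at h1
      have : 0 ≤ K / R ^ (2 * i) * x ^ (2 * (d + i)) := by
        have hR0 : 0 < R := by linarith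
        rw [pow_mul x]
        positivity
      linarith
    · push Not at hx
      have hx1 : 1 ≤ |x| := hR1.trans hx.le
      have h1 : |g x - P.eval x| ≤ K * |x| ^ d := by
        have hg : |g x| ≤ ‖g‖ * |x| ^ d :=
          (g.norm_coe_le_norm x).trans (le_mul_of_one_le_right (norm_nonneg _) (one_le_pow₀ hx1))
        calc |g x - P.eval x| ≤ |g x| + |P.eval x| := abs_sub _ _
          _ ≤ _ := by
            rw [hK, add_mul]
            exact add_le_add hg (abs_eval_le_sum_abs_mul_pow P hx1)
      have h2 : |x| ^ d ≤ |x| ^ (2 * d) := pow_le_pow_right₀ hx1 (by omega)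
      have h3 : R ^ (2 * i) ≤ |x| ^ (2 * i) := pow_le_pow_left₀ (by linarith) hx.le _
      have h4 : K * |x| ^ d ≤ K / R ^ (2 * i) * x ^ (2 * (d + i)) := by
        have hx2 : x ^ (2 * (d + i)) = |x| ^ (2 * d) * |x| ^ (2 * i) := by
          rw [← pow_add, ← mul_add, pow_mul, pow_mul, sq_abs]
        rw [hx2, div_mul_eq_mul_div, le_div_iff₀ (by positivity), mul_assoc]
        gcongr
      linarith
  have hdiff : ∀ (m : ProbabilityMeasure ℝ),
      (∀ k : ℕ, Integrable (fun x : ℝ => x ^ k) (m : Measure ℝ)) →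
      |∫ x, g x ∂(m : Measure ℝ) - ∫ x, P.eval x ∂(m : Measure ℝ)| ≤
        ∫ x, H.eval x ∂(m : Measure ℝ) := by
    intro m hm
    rw [← integral_sub (g.integrable _) (integrable_eval_of_integrable_pow hm P)]
    refine (abs_integral_le_integral_abs).trans (integral_mono_of_nonneg
      (Eventually.of_forall fun x => abs_nonneg _) (integrable_eval_of_integrable_pow hm H)
      (Eventually.of_forall hbound))
  have hHμ : ∫ x, H.eval x ∂(μ : Measure ℝ) < 2 * δ := by
    have hle : ∫ x, H.eval x ∂(μ : Measure ℝ) ≤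
        ∫ _, (δ + K * c ^ (2 * d) * (c / R) ^ (2 * i)) ∂(μ : Measure ℝ) := by
      refine integral_mono_ae (integrable_eval_of_integrable_pow hintμ H) (integrable_const _) ?_
      filter_upwards [hc] with x hx
      rw [hHev]
      have hx2 : x ^ (2 * (d + i)) ≤ c ^ (2 * (d + i)) := by
        rw [pow_mul x, ← sq_abs, ← pow_mul]
        exact pow_le_pow_left₀ (abs_nonneg _) hx _
      have : K * c ^ (2 * d) * (c / R) ^ (2 * i) = K / R ^ (2 * i) * c ^ (2 * (d + i)) := by
        rw [div_pow, mul_add, pow_add]; ring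
      rw [this]
      gcongr
    rw [integral_const] at hle
    simp only [probReal_univ, one_smul] at hle
    linarith
  have e1 := (hpoly H).eventually (gt_mem_nhds hHμ)
  have e2 := Metric.tendsto_atTop.1 (hpoly P) δ hδ0
  obtain ⟨N1, hN1⟩ := eventually_atTop.1 e1
  obtain ⟨N2, hN2⟩ := e2
  refine ⟨max N1 N2, fun n hn => ?_⟩
  have a1 := (abs_le.1 ((hdiff (μs n) (hint n)).trans (hN1 n (le_of_max_le_left hn)).le))
  have a2 := (abs_le.1 ((hdiff μ hintμ).trans hHμ.le))
  have a3 := abs_lt.1 (hN2 n (le_of_max_le_right hn))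
  rw [Real.dist_eq, abs_lt]
  constructor <;> linarith [a1.1, a1.2, a2.1, a2.2, a3.1, a3.2]

/-- The uniform probability measure on a nonempty multiset of reals. -/
noncomputable def empiricalMeasure (s : Multiset ℝ) : Measure ℝ :=
  (s.card : ENNReal)⁻¹ • (s.map Measure.dirac).sum

theorem sum_map_dirac_apply (s : Multiset ℝ) {A : Set ℝ} (hA : MeasurableSet A) :
    (s.map Measure.dirac).sum A = ((s.filter (· ∈ A)).card : ENNReal) := by
  induction s using Multiset.induction with
  | empty => simp
  | cons x s ih =>
    rw [Multiset.map_cons, Multiset.sum_cons, Measure.add_apply, ih, Measure.dirac_apply' _ hA,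
      Multiset.filter_cons]
    by_cases h : x ∈ A <;> simp [h, add_comm]

theorem integral_sum_map_dirac (s : Multiset ℝ) (g : ℝ → ℝ) :
    Integrable g (s.map Measure.dirac).sum ∧
      ∫ x, g x ∂(s.map Measure.dirac).sum = (s.map g).sum := by
  induction s using Multiset.induction with
  | empty => simp
  | cons x s ih =>
    have hx : Integrable g (Measure.dirac x) := integrable_dirac (by finiteness)
    rw [Multiset.map_cons, Multiset.sum_cons, Multiset.map_cons, Multiset.sum_cons,
      integral_add_measure hx ih.1, integral_dirac, ih.2]
    exact ⟨hx.add_measure ih.1, rfl⟩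

theorem isProbabilityMeasure_empiricalMeasure {s : Multiset ℝ} (hs : s.card ≠ 0) :
    IsProbabilityMeasure (empiricalMeasure s) := by
  constructor
  rw [empiricalMeasure, Measure.smul_apply, sum_map_dirac_apply _ MeasurableSet.univ]
  simp only [Set.mem_univ, Multiset.filter_true, smul_eq_mul]
  exact ENNReal.inv_mul_cancel (by exact_mod_cast hs) (by simp)

theorem integrable_empiricalMeasure {s : Multiset ℝ} (hs : s.card ≠ 0) (g : ℝ → ℝ) :
    Integrable g (empiricalMeasure s) :=
  (integral_sum_map_dirac s g).1.smul_measure (by simpa using hs)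

theorem integral_empiricalMeasure (s : Multiset ℝ) (g : ℝ → ℝ) :
    ∫ x, g x ∂(empiricalMeasure s) = (s.card : ℝ)⁻¹ * (s.map g).sum := by
  rw [empiricalMeasure, integral_smul_measure, (integral_sum_map_dirac s g).2]
  simp

theorem empiricalMeasure_real (s : Multiset ℝ) {A : Set ℝ} (hA : MeasurableSet A) :
    (empiricalMeasure s).real A = ((s.filter (· ∈ A)).card : ℝ) / s.card := by
  rw [empiricalMeasure, Measure.real, Measure.smul_apply, sum_map_dirac_apply _ hA]
  simp [div_eq_inv_mul]

/-! ### The limiting distribution -/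

section LimitMeasure

/-- The parametrization `ρ` of the support of the limiting distribution. -/
noncomputable def rhoParam (r : ℕ) (φ : ℝ) : ℝ :=
  sin (((r : ℝ) + 1) * φ) ^ (r + 1) / (sin φ * sin ((r : ℝ) * φ) ^ r)

/-- The phase function `f`. -/
noncomputable def phase (r : ℕ) (φ : ℝ) : ℝ :=
  ((r : ℝ) + 1) * φ - (r : ℝ) * (sin (((r : ℝ) + 1) * φ) / sin ((r : ℝ) * φ)) * sin φ

/-- The logarithmic derivative of `rhoParam`. -/
noncomputable def rhoLogDeriv (r : ℕ) (φ : ℝ) : ℝ :=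
  ((r : ℝ) + 1) ^ 2 * (cos (((r : ℝ) + 1) * φ) / sin (((r : ℝ) + 1) * φ)) - cos φ / sin φ -
    (r : ℝ) ^ 2 * (cos ((r : ℝ) * φ) / sin ((r : ℝ) * φ))

/-- The derivative of `phase`. -/
noncomputable def phaseDeriv (r : ℕ) (φ : ℝ) : ℝ :=
  sin (((r : ℝ) + 1) * φ) * sin φ / sin ((r : ℝ) * φ) * -rhoLogDeriv r φ

theorem sin_add_one_mul (r : ℕ) (φ : ℝ) : sin (((r : ℝ) + 1) * φ) =
    sin φ * cos ((r : ℝ) * φ) + cos φ * sin ((r : ℝ) * φ) := by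
  rw [add_mul, one_mul, sin_add]; ring

theorem cos_add_one_mul (r : ℕ) (φ : ℝ) : cos (((r : ℝ) + 1) * φ) =
    cos φ * cos ((r : ℝ) * φ) - sin φ * sin ((r : ℝ) * φ) := by
  rw [add_mul, one_mul, cos_add]; ring

theorem abs_sin_natCast_mul_le (n : ℕ) (x : ℝ) : |sin ((n : ℝ) * x)| ≤ n * |sin x| := by
  induction n with
  | zero => simp
  | succ n ih =>
    push_cast
    rw [sin_add_one_mul]
    have h1 : |sin x * cos ((n : ℝ) * x)| ≤ |sin x| := by
      rw [abs_mul]; exact mul_le_of_le_one_right (abs_nonneg _) (abs_cos_le_one _)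
    have h2 : |cos x * sin ((n : ℝ) * x)| ≤ |sin ((n : ℝ) * x)| := by
      rw [abs_mul]; exact mul_le_of_le_one_left (abs_nonneg _) (abs_cos_le_one _)
    have h3 := abs_add_le (sin x * cos ((n : ℝ) * x)) (cos x * sin ((n : ℝ) * x))
    linarith

variable {r : ℕ} {φ : ℝ}

theorem add_one_mul_lt_pi (hφ : φ ∈ Set.Ioo 0 (π / ((r : ℝ) + 1))) : ((r : ℝ) + 1) * φ < π := by
  have := (lt_div_iff₀ (by positivity)).1 hφ.2
  linarith

theorem sin_pos_of_mem (hφ : φ ∈ Set.Ioo 0 (π / ((r : ℝ) + 1))) : 0 < sin φ := by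
  have h := add_one_mul_lt_pi hφ
  have : 0 ≤ (r : ℝ) * φ := mul_nonneg (by positivity) hφ.1.le
  exact sin_pos_of_pos_of_lt_pi hφ.1 (by linarith)

theorem sin_mul_pos_of_mem (hr : 1 ≤ r) (hφ : φ ∈ Set.Ioo 0 (π / ((r : ℝ) + 1))) :
    0 < sin ((r : ℝ) * φ) := by
  have h := add_one_mul_lt_pi hφ
  have hr' : (1 : ℝ) ≤ r := by exact_mod_cast hr
  exact sin_pos_of_pos_of_lt_pi (mul_pos (by linarith) hφ.1) (by linarith [hφ.1])

theorem sin_add_one_mul_pos_of_mem (hφ : φ ∈ Set.Ioo 0 (π / ((r : ℝ) + 1))) :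
    0 < sin (((r : ℝ) + 1) * φ) :=
  sin_pos_of_pos_of_lt_pi (mul_pos (by positivity) hφ.1) (add_one_mul_lt_pi hφ)

theorem sin_le_sin_mul_of_mem (hr : 1 ≤ r) (hφ : φ ∈ Set.Ioo 0 (π / ((r : ℝ) + 1))) :
    sin φ ≤ sin ((r : ℝ) * φ) := by
  have h := add_one_mul_lt_pi hφ
  have hr' : (1 : ℝ) ≤ r := by exact_mod_cast hr
  have h1 : φ ≤ r * φ := le_mul_of_one_le_left hφ.1.le hr'
  rw [← sub_nonneg, sin_sub_sin]
  refine mul_nonneg (mul_nonneg zero_le_two (sin_nonneg_of_nonneg_of_le_pi ?_ ?_))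
    (cos_nonneg_of_mem_Icc ⟨?_, ?_⟩) <;> linarith [hφ.1]

theorem sin_mul_le_of_mem (hφ : φ ∈ Set.Ioo 0 (π / ((r : ℝ) + 1))) :
    sin ((r : ℝ) * φ) ≤ r * sin φ := by
  have := (le_abs_self _).trans (abs_sin_natCast_mul_le r φ)
  rwa [abs_of_pos (sin_pos_of_mem hφ)] at this

theorem sin_add_one_mul_div_le_two (hr : 1 ≤ r) (hφ : φ ∈ Set.Ioo 0 (π / ((r : ℝ) + 1))) :
    sin (((r : ℝ) + 1) * φ) / sin ((r : ℝ) * φ) ≤ 2 := by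
  have ht := sin_mul_pos_of_mem hr hφ
  have ha := sin_pos_of_mem hφ
  rw [div_le_iff₀ ht, sin_add_one_mul]
  nlinarith [sin_le_sin_mul_of_mem hr hφ, cos_le_one φ, cos_le_one ((r : ℝ) * φ)]

theorem rhoParam_eq (hr : 1 ≤ r) (hφ : φ ∈ Set.Ioo 0 (π / ((r : ℝ) + 1))) :
    rhoParam r φ = (sin (((r : ℝ) + 1) * φ) / sin ((r : ℝ) * φ)) ^ r *
      (sin (((r : ℝ) + 1) * φ) / sin φ) := by
  have ht := (sin_mul_pos_of_mem hr hφ).ne'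
  have ha := (sin_pos_of_mem hφ).ne'
  rw [rhoParam, div_pow]
  field_simp
  ring

theorem rhoParam_pos (hr : 1 ≤ r) (hφ : φ ∈ Set.Ioo 0 (π / ((r : ℝ) + 1))) :
    0 < rhoParam r φ := by
  have ht := sin_mul_pos_of_mem hr hφ
  have ha := sin_pos_of_mem hφ
  have hS := sin_add_one_mul_pos_of_mem hφ
  unfold rhoParam
  positivity

theorem rhoParam_le (hr : 1 ≤ r) (hφ : φ ∈ Set.Ioo 0 (π / ((r : ℝ) + 1))) :
    rhoParam r φ ≤ 2 ^ r * (r + 1) := by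
  have ht := sin_mul_pos_of_mem hr hφ
  have ha := sin_pos_of_mem hφ
  have hS := sin_add_one_mul_pos_of_mem hφ
  have h2 : sin (((r : ℝ) + 1) * φ) / sin φ ≤ r + 1 := by
    rw [div_le_iff₀ ha]
    have := (le_abs_self _).trans (abs_sin_natCast_mul_le (r + 1) φ)
    rw [abs_of_pos ha] at this
    exact_mod_cast this
  rw [rhoParam_eq hr hφ]
  have h1 := sin_add_one_mul_div_le_two hr hφ
  gcongr

theorem rhoLogDeriv_neg (hr : 1 ≤ r) (hφ : φ ∈ Set.Ioo 0 (π / ((r : ℝ) + 1))) :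
    rhoLogDeriv r φ < 0 := by
  have ht := sin_mul_pos_of_mem hr hφ
  have ha := sin_pos_of_mem hφ
  have hS := sin_add_one_mul_pos_of_mem hφ
  set A := cos φ / sin φ with hA
  set T := cos ((r : ℝ) * φ) / sin ((r : ℝ) * φ) with hT
  have hSum : sin (((r : ℝ) + 1) * φ) = (A + T) * (sin φ * sin ((r : ℝ) * φ)) := by
    rw [sin_add_one_mul, hA, hT]; field_simp; ring
  have hcos : cos (((r : ℝ) + 1) * φ) = (A * T - 1) * (sin φ * sin ((r : ℝ) * φ)) := by
    rw [cos_add_one_mul, hA, hT]; field_simp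
  have hAT : 0 < A + T := by
    rw [hSum] at hS
    exact (mul_pos_iff_of_pos_right (mul_pos ha ht)).1 hS
  have hq : cos (((r : ℝ) + 1) * φ) / sin (((r : ℝ) + 1) * φ) = (A * T - 1) / (A + T) := by
    rw [hcos, hSum, mul_div_mul_right _ _ (mul_pos ha ht).ne']
  have : rhoLogDeriv r φ = -((A - r * T) ^ 2 + (r + 1) ^ 2) / (A + T) := by
    rw [rhoLogDeriv, hq, ← hA, ← hT]
    field_simp
    ring
  rw [this]
  exact div_neg_of_neg_of_pos (neg_neg_of_pos (by positivity)) hAT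

theorem phaseDeriv_pos (hr : 1 ≤ r) (hφ : φ ∈ Set.Ioo 0 (π / ((r : ℝ) + 1))) :
    0 < phaseDeriv r φ := by
  have ht := sin_mul_pos_of_mem hr hφ
  have ha := sin_pos_of_mem hφ
  have hS := sin_add_one_mul_pos_of_mem hφ
  have := rhoLogDeriv_neg hr hφ
  exact mul_pos (by positivity) (by linarith)

theorem hasDerivAt_sin_mul (c φ : ℝ) : HasDerivAt (fun x => sin (c * x)) (c * cos (c * φ)) φ := by
  have h : HasDerivAt (fun x => c * x) c φ := by simpa using (hasDerivAt_id φ).const_mul c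
  simpa [mul_comm] using h.sin

theorem hasDerivAt_rhoParam (hr : 1 ≤ r) (hφ : φ ∈ Set.Ioo 0 (π / ((r : ℝ) + 1))) :
    HasDerivAt (rhoParam r) (rhoParam r φ * rhoLogDeriv r φ) φ := by
  have ht := (sin_mul_pos_of_mem hr hφ).ne'
  have ha := (sin_pos_of_mem hφ).ne'
  have hS := (sin_add_one_mul_pos_of_mem hφ).ne'
  have h := ((hasDerivAt_sin_mul ((r : ℝ) + 1) φ).pow (r + 1)).div
    ((hasDerivAt_sin φ).mul ((hasDerivAt_sin_mul r φ).pow r)) (mul_ne_zero ha (pow_ne_zero _ ht))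
  refine h.congr_deriv ?_
  obtain ⟨m, rfl⟩ := Nat.exists_eq_add_of_le' hr
  simp only [rhoParam, rhoLogDeriv, Pi.mul_apply, Pi.pow_apply, Nat.add_sub_cancel] at *
  field_simp
  push_cast
  ring

theorem phaseDeriv_eq (hr : 1 ≤ r) (hφ : φ ∈ Set.Ioo 0 (π / ((r : ℝ) + 1))) :
    phaseDeriv r φ = ((r : ℝ) + 1) - r * (sin φ / sin ((r : ℝ) * φ) *
      ((cos φ / sin φ - r * (cos ((r : ℝ) * φ) / sin ((r : ℝ) * φ))) * sin (((r : ℝ) + 1) * φ) +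
        ((r : ℝ) + 1) * cos (((r : ℝ) + 1) * φ))) := by
  have ht := (sin_mul_pos_of_mem hr hφ).ne'
  have ha := (sin_pos_of_mem hφ).ne'
  have hS := (sin_add_one_mul_pos_of_mem hφ).ne'
  rw [phaseDeriv, rhoLogDeriv]
  field_simp
  rw [sin_add_one_mul, cos_add_one_mul]
  linear_combination ((r : ℝ) + 1) * sin ((r : ℝ) * φ) ^ 2 * sin_sq_add_cos_sq φ

theorem hasDerivAt_phase (hr : 1 ≤ r) (hφ : φ ∈ Set.Ioo 0 (π / ((r : ℝ) + 1))) :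
    HasDerivAt (phase r) (phaseDeriv r φ) φ := by
  have ht := (sin_mul_pos_of_mem hr hφ).ne'
  have ha := (sin_pos_of_mem hφ).ne'
  have h1 : HasDerivAt (fun x : ℝ => ((r : ℝ) + 1) * x) ((r : ℝ) + 1) φ := by
    simpa using (hasDerivAt_id φ).const_mul ((r : ℝ) + 1)
  have h := h1.sub ((((hasDerivAt_sin_mul ((r : ℝ) + 1) φ).div (hasDerivAt_sin_mul r φ)
    ht).const_mul (r : ℝ)).mul (hasDerivAt_sin φ))
  refine h.congr_deriv ?_
  rw [phaseDeriv_eq hr hφ]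
  simp only [Pi.div_apply]
  field_simp
  ring

theorem strictAntiOn_rhoParam (hr : 1 ≤ r) :
    StrictAntiOn (rhoParam r) (Set.Ioo 0 (π / ((r : ℝ) + 1))) := by
  refine strictAntiOn_of_deriv_neg (convex_Ioo _ _)
    (fun φ hφ => (hasDerivAt_rhoParam hr hφ).continuousAt.continuousWithinAt) fun φ hφ => ?_
  rw [interior_Ioo] at hφ
  rw [(hasDerivAt_rhoParam hr hφ).deriv]
  exact mul_neg_of_pos_of_neg (rhoParam_pos hr hφ) (rhoLogDeriv_neg hr hφ)

theorem phase_zero (r : ℕ) : phase r 0 = 0 := by simp [phase]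

theorem phase_right_end (r : ℕ) : phase r (π / ((r : ℝ) + 1)) = π := by
  have : ((r : ℝ) + 1) * (π / ((r : ℝ) + 1)) = π := by field_simp
  simp [phase, this]

theorem continuousOn_phase (hr : 1 ≤ r) :
    ContinuousOn (phase r) (Set.Icc 0 (π / ((r : ℝ) + 1))) := by
  have hr' : (1 : ℝ) ≤ r := by exact_mod_cast hr
  have hb : ((r : ℝ) + 1) * (π / ((r : ℝ) + 1)) = π := by field_simp
  intro φ hφ
  rcases eq_or_lt_of_le hφ.1 with rfl | h0
  · have hlim : Tendsto (fun x : ℝ => ((r : ℝ) + 1) * |x| + r * 2 * |sin x|)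
        (nhdsWithin 0 (Set.Icc 0 (π / ((r : ℝ) + 1)))) (nhds 0) := by
      have : Continuous fun x : ℝ => ((r : ℝ) + 1) * |x| + r * 2 * |sin x| := by fun_prop
      have h := (this.tendsto 0).mono_left
        (nhdsWithin_le_nhds (s := Set.Icc 0 (π / ((r : ℝ) + 1))))
      simpa using h
    rw [ContinuousWithinAt, phase_zero]
    refine squeeze_zero_norm' ?_ hlim
    filter_upwards [self_mem_nhdsWithin] with x hx
    rcases eq_or_lt_of_le hx.1 with rfl | hx0
    · simp [phase_zero]
    rcases eq_or_lt_of_le hx.2 with rfl | hxb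
    · rw [phase_right_end, norm_of_nonneg pi_pos.le, abs_of_pos hx0, hb]
      have : 0 ≤ (r : ℝ) * 2 * |sin (π / ((r : ℝ) + 1))| := by positivity
      linarith
    · have hmem : x ∈ Set.Ioo 0 (π / ((r : ℝ) + 1)) := ⟨hx0, hxb⟩
      have hS := sin_add_one_mul_pos_of_mem hmem
      have ht := sin_mul_pos_of_mem hr hmem
      rw [phase, Real.norm_eq_abs]
      refine (abs_sub _ _).trans (add_le_add ?_ ?_)
      · rw [abs_mul, abs_of_pos (by positivity : (0 : ℝ) < r + 1)]
      · rw [abs_mul, abs_mul, abs_of_nonneg (by positivity : (0 : ℝ) ≤ r),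
          abs_of_pos (div_pos hS ht)]
        have := sin_add_one_mul_div_le_two hr hmem
        gcongr
  · have ht : sin ((r : ℝ) * φ) ≠ 0 := by
      refine (sin_pos_of_pos_of_lt_pi (mul_pos (by linarith) h0) ?_).ne'
      have := mul_le_mul_of_nonneg_left hφ.2 (by positivity : (0 : ℝ) ≤ (r : ℝ) + 1)
      rw [hb] at this
      linarith
    apply ContinuousAt.continuousWithinAt
    unfold phase
    fun_prop (disch := assumption)

theorem integrableOn_phaseDeriv (hr : 1 ≤ r) :
    IntegrableOn (phaseDeriv r) (Set.Ioc 0 (π / ((r : ℝ) + 1))) :=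
  intervalIntegral.integrableOn_deriv_of_nonneg (continuousOn_phase hr)
    (fun _ hφ => hasDerivAt_phase hr hφ) fun _ hφ => (phaseDeriv_pos hr hφ).le

theorem measurable_rhoParam (r : ℕ) : Measurable (rhoParam r) := by
  unfold rhoParam
  fun_prop

theorem measurable_phaseDeriv (r : ℕ) : Measurable (phaseDeriv r) := by
  unfold phaseDeriv rhoLogDeriv
  fun_prop

theorem integral_phaseDeriv (hr : 1 ≤ r) {α β : ℝ} (hα : 0 ≤ α) (hαβ : α ≤ β)
    (hβ : β ≤ π / ((r : ℝ) + 1)) :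
    ∫ φ in α..β, phaseDeriv r φ = phase r β - phase r α := by
  refine intervalIntegral.integral_eq_sub_of_hasDerivAt_of_le hαβ
    ((continuousOn_phase hr).mono (Set.Icc_subset_Icc hα hβ))
    (fun φ hφ => hasDerivAt_phase hr ⟨hα.trans_lt hφ.1, hφ.2.trans_le hβ⟩) ?_
  rw [intervalIntegrable_iff_integrableOn_Ioc_of_le hαβ]
  exact (integrableOn_phaseDeriv hr).mono_set (Set.Ioc_subset_Ioc hα hβ)

/-- The curve along which the moments of the limiting distribution become residues. -/
noncomputable def momentCurve (r : ℕ) (φ : ℝ) : ℂ :=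
  ((sin φ / sin ((r : ℝ) * φ) : ℝ) : ℂ) * Complex.exp (((((r : ℝ) + 1) * φ : ℝ) : ℂ) * Complex.I)

/-- The logarithmic derivative of `momentCurve`. -/
noncomputable def momentCurveLogDeriv (r : ℕ) (φ : ℝ) : ℂ :=
  ⟨cos φ / sin φ - r * (cos ((r : ℝ) * φ) / sin ((r : ℝ) * φ)), (r : ℝ) + 1⟩

/-- A primitive of the imaginary part of `momentCurveLogDeriv r * momentCurve r ^ m`. -/
noncomputable def momentPrimitive (r : ℕ) (m : ℤ) (φ : ℝ) : ℝ :=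
  if m = 0 then ((r : ℝ) + 1) * φ else (momentCurve r φ ^ m).im / m

theorem momentCurve_ne_zero (hr : 1 ≤ r) (hφ : φ ∈ Set.Ioo 0 (π / ((r : ℝ) + 1))) :
    momentCurve r φ ≠ 0 :=
  mul_ne_zero (Complex.ofReal_ne_zero.2
    (div_pos (sin_pos_of_mem hφ) (sin_mul_pos_of_mem hr hφ)).ne') (Complex.exp_ne_zero _)

theorem hasDerivAt_momentCurve (hr : 1 ≤ r) (hφ : φ ∈ Set.Ioo 0 (π / ((r : ℝ) + 1))) :
    HasDerivAt (momentCurve r) (momentCurve r φ * momentCurveLogDeriv r φ) φ := by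
  have ht := (sin_mul_pos_of_mem hr hφ).ne'
  have ha := (sin_pos_of_mem hφ).ne'
  have h1 := ((hasDerivAt_sin φ).div (hasDerivAt_sin_mul r φ) ht).ofReal_comp
  have h2 : HasDerivAt (fun x : ℝ => ((((r : ℝ) + 1) * x : ℝ) : ℂ) * Complex.I)
      ((((r : ℝ) + 1 : ℝ) : ℂ) * Complex.I) φ := by
    have : HasDerivAt (fun x : ℝ => ((r : ℝ) + 1) * x) ((r : ℝ) + 1) φ := by
      simpa using (hasDerivAt_id φ).const_mul ((r : ℝ) + 1)
    exact this.ofReal_comp.mul_const _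
  refine (h1.mul h2.cexp).congr_deriv ?_
  have hlog : momentCurveLogDeriv r φ =
      ((cos φ / sin φ - r * (cos ((r : ℝ) * φ) / sin ((r : ℝ) * φ)) : ℝ) : ℂ) +
        (((r : ℝ) + 1 : ℝ) : ℂ) * Complex.I := by
    rw [momentCurveLogDeriv, Complex.mk_eq_add_mul_I]
  have hq : (cos φ * sin ((r : ℝ) * φ) - sin φ * ((r : ℝ) * cos ((r : ℝ) * φ))) /
      sin ((r : ℝ) * φ) ^ 2 = sin φ / sin ((r : ℝ) * φ) *
        (cos φ / sin φ - r * (cos ((r : ℝ) * φ) / sin ((r : ℝ) * φ))) := by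
    field_simp
  rw [hlog, hq, momentCurve]
  simp only [Complex.ofReal_mul, Pi.div_apply]
  ring

theorem hasDerivAt_momentPrimitive (hr : 1 ≤ r) (m : ℤ)
    (hφ : φ ∈ Set.Ioo 0 (π / ((r : ℝ) + 1))) :
    HasDerivAt (momentPrimitive r m) (momentCurveLogDeriv r φ * momentCurve r φ ^ m).im φ := by
  unfold momentPrimitive
  split_ifs with hm
  · subst hm
    simpa [momentCurveLogDeriv] using (hasDerivAt_id φ).const_mul ((r : ℝ) + 1)
  · have hu := momentCurve_ne_zero hr hφ
    have h := (hasDerivAt_zpow m (momentCurve r φ) (Or.inl hu)).comp φ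
      (hasDerivAt_momentCurve hr hφ)
    have h' := (Complex.imCLM.hasFDerivAt.comp_hasDerivAt φ h).div_const (m : ℝ)
    refine h'.congr_deriv ?_
    have hm' : (m : ℝ) ≠ 0 := by exact_mod_cast hm
    have : (m : ℂ) * momentCurve r φ ^ (m - 1) * (momentCurve r φ * momentCurveLogDeriv r φ) =
        ((m : ℝ) : ℂ) * (momentCurveLogDeriv r φ * momentCurve r φ ^ m) := by
      rw [zpow_sub_one₀ hu]
      field_simp
      simp [mul_comm]
    rw [this, Complex.imCLM_apply, Complex.im_ofReal_mul]
    field_simp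

theorem im_momentCurve_zpow (r : ℕ) (m : ℤ) (φ : ℝ) : (momentCurve r φ ^ m).im =
    (sin φ / sin ((r : ℝ) * φ)) ^ m * sin (m * (((r : ℝ) + 1) * φ)) := by
  rw [momentCurve, mul_zpow, ← Complex.exp_int_mul, ← Complex.ofReal_zpow, Complex.im_ofReal_mul,
    ← mul_assoc, ← Complex.ofReal_intCast, ← Complex.ofReal_mul, Complex.exp_ofReal_mul_I_im]

theorem zpow_sin_div_le (hr : 1 ≤ r) (m : ℤ) (hφ : φ ∈ Set.Ioo 0 (π / ((r : ℝ) + 1))) :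
    (sin φ / sin ((r : ℝ) * φ)) ^ m ≤ (r : ℝ) ^ m.natAbs := by
  have ht := sin_mul_pos_of_mem hr hφ
  have ha := sin_pos_of_mem hφ
  have hr' : (1 : ℝ) ≤ r := by exact_mod_cast hr
  obtain ⟨n, rfl | rfl⟩ := m.eq_nat_or_neg
  · rw [zpow_natCast, Int.natAbs_natCast]
    refine pow_le_pow_left₀ (div_pos ha ht).le ?_ n
    exact ((div_le_one ht).2 (sin_le_sin_mul_of_mem hr hφ)).trans hr'
  · rw [zpow_neg, zpow_natCast, Int.natAbs_neg, Int.natAbs_natCast, ← inv_pow, inv_div]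
    refine pow_le_pow_left₀ (div_pos ht ha).le ?_ n
    exact (div_le_iff₀ ha).2 (sin_mul_le_of_mem hφ)

theorem tendsto_momentPrimitive (hr : 1 ≤ r) {m : ℤ} (hm : m ≠ 0) {c : ℝ} {l : Filter ℝ}
    (hl : l ≤ nhds c) (hmem : ∀ᶠ φ in l, φ ∈ Set.Ioo 0 (π / ((r : ℝ) + 1)))
    (hc : sin (m * (((r : ℝ) + 1) * c)) = 0) :
    Tendsto (momentPrimitive r m) l (nhds 0) := by
  have hcont : Continuous fun φ : ℝ =>
      (r : ℝ) ^ m.natAbs * |sin (m * (((r : ℝ) + 1) * φ))| / |(m : ℝ)| := by fun_prop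
  have hlim := (hcont.tendsto c).mono_left hl
  rw [hc, abs_zero, mul_zero, zero_div] at hlim
  refine squeeze_zero_norm' ?_ hlim
  filter_upwards [hmem] with φ hφ
  have hq := div_pos (sin_pos_of_mem hφ) (sin_mul_pos_of_mem hr hφ)
  rw [momentPrimitive, if_neg hm, im_momentCurve_zpow, Real.norm_eq_abs, abs_div, abs_mul,
    abs_of_pos (zpow_pos hq m)]
  have := zpow_sin_div_le hr m hφ
  gcongr

theorem tendsto_momentPrimitive_left (hr : 1 ≤ r) (m : ℤ) :
    Tendsto (momentPrimitive r m) (nhdsWithin 0 (Set.Ioi 0)) (nhds 0) := by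
  by_cases hm : m = 0
  · have : Continuous fun φ : ℝ => ((r : ℝ) + 1) * φ := by fun_prop
    have h := (this.tendsto 0).mono_left (nhdsWithin_le_nhds (s := Set.Ioi 0))
    rw [mul_zero] at h
    exact h.congr fun φ => by simp [momentPrimitive, hm]
  · exact tendsto_momentPrimitive hr hm nhdsWithin_le_nhds
      (Ioo_mem_nhdsGT (by positivity)) (by simp)

theorem tendsto_momentPrimitive_right (hr : 1 ≤ r) (m : ℤ) :
    Tendsto (momentPrimitive r m)
      (nhdsWithin (π / ((r : ℝ) + 1)) (Set.Iio (π / ((r : ℝ) + 1))))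
      (nhds (if m = 0 then π else 0)) := by
  have hb : ((r : ℝ) + 1) * (π / ((r : ℝ) + 1)) = π := by field_simp
  split_ifs with hm
  · have : Continuous fun φ : ℝ => ((r : ℝ) + 1) * φ := by fun_prop
    have h := (this.tendsto (π / ((r : ℝ) + 1))).mono_left
      (nhdsWithin_le_nhds (s := Set.Iio (π / ((r : ℝ) + 1))))
    rw [hb] at h
    exact h.congr fun φ => by simp [momentPrimitive, hm]
  · exact tendsto_momentPrimitive hr hm nhdsWithin_le_nhds
      (Ioo_mem_nhdsLT (by positivity)) (by rw [hb, sin_int_mul_pi])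

/-- The coefficients of `(r + 1) (1 + X) ^ (N - 1) - r (1 + X) ^ N` with `N = (r + 1) (k + 1)`. -/
noncomputable def momentCoeff (r k j : ℕ) : ℝ :=
  ((r : ℝ) + 1) * (((r + 1) * k + r).choose j : ℝ) - r * (((r + 1) * (k + 1)).choose j : ℝ)

theorem sum_momentCoeff_mul_pow (r k : ℕ) (u : ℂ) :
    ∑ j ∈ Finset.range ((r + 1) * (k + 1) + 1), (momentCoeff r k j : ℂ) * u ^ j =
      ((r : ℂ) + 1) * (1 + u) ^ ((r + 1) * k + r) - r * (1 + u) ^ ((r + 1) * (k + 1)) := by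
  have hN : (r + 1) * (k + 1) = (r + 1) * k + r + 1 := by ring
  have h1 : (1 + u) ^ ((r + 1) * k + r) =
      ∑ j ∈ Finset.range ((r + 1) * (k + 1) + 1), u ^ j * (((r + 1) * k + r).choose j : ℂ) := by
    rw [add_comm, add_pow, hN, Finset.sum_range_succ _ ((r + 1) * k + r + 1),
      Nat.choose_succ_self]
    simp
  have h2 : (1 + u) ^ ((r + 1) * (k + 1)) =
      ∑ j ∈ Finset.range ((r + 1) * (k + 1) + 1), u ^ j * (((r + 1) * (k + 1)).choose j : ℂ) := by
    rw [add_comm, add_pow]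
    simp
  rw [h1, h2, Finset.mul_sum, Finset.mul_sum, ← Finset.sum_sub_distrib]
  refine Finset.sum_congr rfl fun j _ => ?_
  rw [momentCoeff]
  push_cast
  ring

theorem momentCoeff_self (r k : ℕ) :
    ((k : ℝ) + 1) * momentCoeff r k k = ((r + 1) * (k + 1)).choose k := by
  have h := Nat.choose_mul_succ_eq ((r + 1) * k + r) k
  have hN : (r + 1) * (k + 1) = (r + 1) * k + r + 1 := by ring
  have hsub : (r + 1) * k + r + 1 - k = r * k + r + 1 := by
    rw [Nat.sub_eq_iff_eq_add (by nlinarith)]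
    ring
  rw [hsub, ← hN] at h
  have h' : (((r + 1) * k + r).choose k : ℝ) * (((r : ℝ) + 1) * (k + 1)) =
      ((r + 1) * (k + 1)).choose k * ((r : ℝ) * k + r + 1) := by
    have := congrArg (Nat.cast (R := ℝ)) h
    push_cast at this
    rw [hN]
    rw [hN] at this
    linear_combination this
  rw [momentCoeff]
  linear_combination h'

theorem one_add_momentCurve (hr : 1 ≤ r) (hφ : φ ∈ Set.Ioo 0 (π / ((r : ℝ) + 1))) :
    1 + momentCurve r φ = ((sin (((r : ℝ) + 1) * φ) / sin ((r : ℝ) * φ) : ℝ) : ℂ) *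
      Complex.exp ((φ : ℂ) * Complex.I) := by
  have ht := (sin_mul_pos_of_mem hr hφ).ne'
  have hsin := sin_add_one_mul r φ
  have hcos := cos_add_one_mul r φ
  rw [momentCurve]
  apply Complex.ext
  · rw [Complex.add_re, Complex.re_ofReal_mul, Complex.re_ofReal_mul,
      Complex.exp_ofReal_mul_I_re, Complex.exp_ofReal_mul_I_re, Complex.one_re]
    generalize sin (((r : ℝ) + 1) * φ) = S at *
    generalize cos (((r : ℝ) + 1) * φ) = C at *
    field_simp
    rw [hsin, hcos]
    linear_combination -sin ((r : ℝ) * φ) * sin_sq_add_cos_sq φ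
  · rw [Complex.add_im, Complex.im_ofReal_mul, Complex.im_ofReal_mul,
      Complex.exp_ofReal_mul_I_im, Complex.exp_ofReal_mul_I_im, Complex.one_im]
    ring

theorem one_add_momentCurve_pow (hr : 1 ≤ r) (hφ : φ ∈ Set.Ioo 0 (π / ((r : ℝ) + 1))) :
    (1 + momentCurve r φ) ^ (r + 1) = (rhoParam r φ : ℂ) * momentCurve r φ := by
  have ht := (sin_mul_pos_of_mem hr hφ).ne'
  have ha := (sin_pos_of_mem hφ).ne'
  have h : (sin (((r : ℝ) + 1) * φ) / sin ((r : ℝ) * φ)) ^ (r + 1) =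
      rhoParam r φ * (sin φ / sin ((r : ℝ) * φ)) := by
    rw [rhoParam, div_pow]
    field_simp
    ring
  rw [one_add_momentCurve hr hφ, mul_pow, ← Complex.exp_nat_mul, ← Complex.ofReal_pow, h,
    momentCurve]
  push_cast
  ring_nf

theorem momentCurveLogDeriv_mul (hr : 1 ≤ r) (hφ : φ ∈ Set.Ioo 0 (π / ((r : ℝ) + 1))) :
    momentCurveLogDeriv r φ * momentCurve r φ = (1 + momentCurve r φ) *
      ⟨((r : ℝ) + 1) * (cos (((r : ℝ) + 1) * φ) / sin (((r : ℝ) + 1) * φ)) -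
        r * (cos ((r : ℝ) * φ) / sin ((r : ℝ) * φ)), 1⟩ := by
  have ht := (sin_mul_pos_of_mem hr hφ).ne'
  have ha := (sin_pos_of_mem hφ).ne'
  have hS := (sin_add_one_mul_pos_of_mem hφ).ne'
  have hsin := sin_add_one_mul r φ
  have hcos := cos_add_one_mul r φ
  rw [one_add_momentCurve hr hφ, momentCurve, momentCurveLogDeriv]
  apply Complex.ext
  · simp only [Complex.mul_re, Complex.mul_im, Complex.ofReal_re, Complex.ofReal_im,
      Complex.exp_ofReal_mul_I_re, Complex.exp_ofReal_mul_I_im]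
    generalize sin (((r : ℝ) + 1) * φ) = S at *
    generalize cos (((r : ℝ) + 1) * φ) = C at *
    field_simp
    rw [hsin, hcos]
    ring
  · simp only [Complex.mul_re, Complex.mul_im, Complex.ofReal_re, Complex.ofReal_im,
      Complex.exp_ofReal_mul_I_re, Complex.exp_ofReal_mul_I_im]
    generalize sin (((r : ℝ) + 1) * φ) = S at *
    generalize cos (((r : ℝ) + 1) * φ) = C at *
    field_simp
    rw [hsin, hcos]
    ring

theorem im_momentCurveLogDeriv_mul (hr : 1 ≤ r) (hφ : φ ∈ Set.Ioo 0 (π / ((r : ℝ) + 1))) :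
    phaseDeriv r φ = ((r : ℝ) + 1) - r * (momentCurveLogDeriv r φ * momentCurve r φ).im := by
  rw [phaseDeriv_eq hr hφ, momentCurve, momentCurveLogDeriv]
  simp only [Complex.mul_re, Complex.mul_im, Complex.ofReal_re, Complex.ofReal_im,
    Complex.exp_ofReal_mul_I_re, Complex.exp_ofReal_mul_I_im]
  ring

theorem sum_momentCoeff_mul_im (hr : 1 ≤ r) (k : ℕ) (hφ : φ ∈ Set.Ioo 0 (π / ((r : ℝ) + 1))) :
    ∑ j ∈ Finset.range ((r + 1) * (k + 1) + 1), momentCoeff r k j *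
      (momentCurveLogDeriv r φ * momentCurve r φ ^ ((j : ℤ) - k)).im =
        rhoParam r φ ^ (k + 1) * phaseDeriv r φ := by
  have hu := momentCurve_ne_zero hr hφ
  have hpow := one_add_momentCurve_pow hr hφ
  have hmul := momentCurveLogDeriv_mul hr hφ
  have him := im_momentCurveLogDeriv_mul hr hφ
  set u := momentCurve r φ
  set L := momentCurveLogDeriv r φ
  set η : ℂ := ⟨((r : ℝ) + 1) * (cos (((r : ℝ) + 1) * φ) / sin (((r : ℝ) + 1) * φ)) -
        r * (cos ((r : ℝ) * φ) / sin ((r : ℝ) * φ)), 1⟩ with hη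
  have hN : (1 + u) ^ ((r + 1) * (k + 1)) = (rhoParam r φ : ℂ) ^ (k + 1) * u ^ (k + 1) := by
    rw [pow_mul, hpow, mul_pow]
  have hN' : L * u * (1 + u) ^ ((r + 1) * k + r) =
      (rhoParam r φ : ℂ) ^ (k + 1) * u ^ (k + 1) * η := by
    rw [hmul, ← hN, show (r + 1) * (k + 1) = (r + 1) * k + r + 1 by ring]
    ring
  have hsum : ∑ j ∈ Finset.range ((r + 1) * (k + 1) + 1),
      (momentCoeff r k j : ℂ) * (L * u ^ ((j : ℤ) - k)) =
        ((rhoParam r φ ^ (k + 1) : ℝ) : ℂ) *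
          ((((r : ℝ) + 1 : ℝ) : ℂ) * η - ((r : ℝ) : ℂ) * (L * u)) := by
    have h1 : ∀ j : ℕ, (momentCoeff r k j : ℂ) * (L * u ^ ((j : ℤ) - k)) =
        L / u ^ k * ((momentCoeff r k j : ℂ) * u ^ j) := by
      intro j
      rw [zpow_sub₀ hu, zpow_natCast, zpow_natCast]
      ring
    simp only [h1]
    rw [← Finset.mul_sum, sum_momentCoeff_mul_pow]
    rw [div_mul_eq_mul_div, div_eq_iff (pow_ne_zero _ hu), ← mul_left_inj' hu]
    push_cast
    linear_combination ((r : ℂ) + 1) * hN' - (r : ℂ) * L * u * hN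
  have h2 := congrArg Complex.im hsum
  rw [Complex.im_sum, Complex.im_ofReal_mul, Complex.sub_im, Complex.im_ofReal_mul,
    Complex.im_ofReal_mul] at h2
  simp only [Complex.im_ofReal_mul] at h2
  rw [h2, him, hη]
  ring

theorem intervalIntegrable_pow_mul_phaseDeriv (hr : 1 ≤ r) (k : ℕ) :
    IntervalIntegrable (fun φ => rhoParam r φ ^ k * phaseDeriv r φ) volume 0
      (π / ((r : ℝ) + 1)) := by
  rw [intervalIntegrable_iff_integrableOn_Ioo_of_le (by positivity)]
  refine Integrable.bdd_mul (c := (2 ^ r * ((r : ℝ) + 1)) ^ k)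
    ((integrableOn_phaseDeriv hr).mono_set Set.Ioo_subset_Ioc_self)
    ((measurable_rhoParam r).pow_const k).aestronglyMeasurable ?_
  refine ae_restrict_of_forall_mem measurableSet_Ioo fun φ hφ => ?_
  rw [norm_pow, norm_of_nonneg (rhoParam_pos hr hφ).le]
  exact pow_le_pow_left₀ (rhoParam_pos hr hφ).le (rhoParam_le hr hφ) k

theorem integral_pow_mul_phaseDeriv (hr : 1 ≤ r) (k : ℕ) :
    ∫ φ in (0 : ℝ)..(π / ((r : ℝ) + 1)), rhoParam r φ ^ (k + 1) * phaseDeriv r φ =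
      π * momentCoeff r k k := by
  have h := intervalIntegral.integral_eq_sub_of_hasDerivAt_of_tendsto
    (f := fun φ => ∑ j ∈ Finset.range ((r + 1) * (k + 1) + 1),
      momentCoeff r k j * momentPrimitive r ((j : ℤ) - k) φ)
    (by positivity : (0 : ℝ) < π / ((r : ℝ) + 1))
    (fun φ hφ => (HasDerivAt.fun_sum fun (j : ℕ) _ =>
      (hasDerivAt_momentPrimitive hr ((j : ℤ) - k) hφ).const_mul (momentCoeff r k j)).congr_deriv
        (sum_momentCoeff_mul_im hr k hφ))
    (intervalIntegrable_pow_mul_phaseDeriv hr (k + 1))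
    (tendsto_finsetSum _ fun (j : ℕ) _ => (tendsto_momentPrimitive_left hr _).const_mul _)
    (tendsto_finsetSum _ fun (j : ℕ) _ => (tendsto_momentPrimitive_right hr _).const_mul _)
  rw [h]
  have hk : k ∈ Finset.range ((r + 1) * (k + 1) + 1) := by
    rw [Finset.mem_range]; nlinarith
  rw [Finset.sum_eq_single_of_mem k hk]
  · simp [mul_comm]
  · intro j _ hj
    rw [if_neg (by omega), mul_zero]

/-- The limiting distribution of the rescaled zeros. -/
noncomputable def limitMeasure (r : ℕ) : Measure ℝ :=
  ((volume.restrict (Set.Ioo 0 (π / ((r : ℝ) + 1)))).withDensity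
    fun φ => ENNReal.ofReal (phaseDeriv r φ / π)).map (rhoParam r)

theorem limitMeasure_apply (r : ℕ) {A : Set ℝ} (hA : MeasurableSet A) : limitMeasure r A =
    ∫⁻ φ in rhoParam r ⁻¹' A ∩ Set.Ioo 0 (π / ((r : ℝ) + 1)),
      ENNReal.ofReal (phaseDeriv r φ / π) := by
  have hA' := measurable_rhoParam r hA
  rw [limitMeasure, Measure.map_apply (measurable_rhoParam r) hA, withDensity_apply _ hA',
    Measure.restrict_restrict hA']

theorem limitMeasure_of_preimage_eq_Ioo (hr : 1 ≤ r) {A : Set ℝ} (hA : MeasurableSet A) {α β : ℝ}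
    (hα : 0 ≤ α) (hαβ : α ≤ β) (hβ : β ≤ π / ((r : ℝ) + 1))
    (h : rhoParam r ⁻¹' A ∩ Set.Ioo 0 (π / ((r : ℝ) + 1)) = Set.Ioo α β) :
    limitMeasure r A = ENNReal.ofReal ((phase r β - phase r α) / π) := by
  rw [limitMeasure_apply r hA, h, ← ofReal_integral_eq_lintegral_ofReal, integral_div,
    ← integral_Ioc_eq_integral_Ioo, ← intervalIntegral.integral_of_le hαβ,
    integral_phaseDeriv hr hα hαβ hβ]
  · exact ((integrableOn_phaseDeriv hr).mono_set
      (Set.Ioo_subset_Ioc_self.trans (Set.Ioc_subset_Ioc hα hβ))).div_const π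
  · refine ae_restrict_of_forall_mem measurableSet_Ioo fun φ hφ => ?_
    exact div_nonneg (phaseDeriv_pos hr ⟨hα.trans_lt hφ.1, hφ.2.trans_le hβ⟩).le pi_pos.le

theorem isProbabilityMeasure_limitMeasure (hr : 1 ≤ r) :
    IsProbabilityMeasure (limitMeasure r) := by
  constructor
  rw [limitMeasure_of_preimage_eq_Ioo hr MeasurableSet.univ le_rfl (by positivity) le_rfl
    (by simp), phase_right_end, phase_zero, sub_zero, div_self pi_ne_zero, ENNReal.ofReal_one]

theorem limitMeasure_singleton (hr : 1 ≤ r) (x : ℝ) : limitMeasure r {x} = 0 := by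
  rw [limitMeasure_apply r (measurableSet_singleton x)]
  refine setLIntegral_measure_zero _ _ (Set.Subsingleton.measure_zero (fun φ hφ ψ hψ => ?_) _)
  exact (strictAntiOn_rhoParam hr).injOn hφ.2 hψ.2 (hφ.1.trans hψ.1.symm)

theorem ae_abs_le_limitMeasure (hr : 1 ≤ r) : ∀ᵐ x ∂limitMeasure r, |x| ≤ 2 ^ r * ((r : ℝ) + 1) := by
  have hm : MeasurableSet {x : ℝ | ¬|x| ≤ 2 ^ r * (r + 1)} :=
    (measurableSet_le measurable_abs measurable_const).compl
  rw [ae_iff, limitMeasure_apply r hm]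
  convert setLIntegral_empty (μ := volume) _
  rw [Set.eq_empty_iff_forall_notMem]
  rintro φ ⟨h, hφ⟩
  refine h ?_
  rw [abs_of_pos (rhoParam_pos hr hφ)]
  exact rhoParam_le hr hφ

theorem integral_pow_limitMeasure (hr : 1 ≤ r) (k : ℕ) : ∫ x, x ^ k ∂limitMeasure r =
    (∫ φ in (0 : ℝ)..(π / ((r : ℝ) + 1)), rhoParam r φ ^ k * phaseDeriv r φ) / π := by
  rw [limitMeasure, integral_map (measurable_rhoParam r).aemeasurable
    (continuous_pow k).aestronglyMeasurable,
    integral_withDensity_eq_integral_toReal_smul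
      ((measurable_phaseDeriv r).div_const π).ennreal_ofReal (by simp),
    intervalIntegral.integral_of_le (by positivity), integral_Ioc_eq_integral_Ioo, ← integral_div]
  refine setIntegral_congr_fun measurableSet_Ioo fun φ hφ => ?_
  simp only [smul_eq_mul]
  rw [ENNReal.toReal_ofReal (div_nonneg (phaseDeriv_pos hr hφ).le pi_pos.le)]
  ring

theorem integral_pow_limitMeasure_eq_coeff (hr : 1 ≤ r) {B : PowerSeries ℝ}
    (hB : B = 1 + PowerSeries.X * B ^ (r + 1)) (k : ℕ) :
    ∫ x, x ^ k ∂limitMeasure r = PowerSeries.coeff k B := by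
  cases k with
  | zero =>
    have := isProbabilityMeasure_limitMeasure hr
    rw [hB]
    simp
  | succ k =>
    rw [integral_pow_limitMeasure hr, integral_pow_mul_phaseDeriv hr,
      mul_div_cancel_left₀ _ pi_ne_zero]
    refine mul_left_cancel₀ (by positivity : ((k : ℝ) + 1) ≠ 0) ?_
    rw [momentCoeff_self, coeff_fussCatalan_series hB]

theorem limitMeasure_Ioo (hr : 1 ≤ r) {α β : ℝ} (hα : α ∈ Set.Ioo 0 (π / ((r : ℝ) + 1)))
    (hβ : β ∈ Set.Ioo 0 (π / ((r : ℝ) + 1))) (h : rhoParam r α < rhoParam r β) :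
    limitMeasure r (Set.Ioo (rhoParam r α) (rhoParam r β)) =
      ENNReal.ofReal ((phase r α - phase r β) / π) := by
  have hanti := strictAntiOn_rhoParam hr
  have hβα : β < α := (hanti.lt_iff_gt hα hβ).1 h
  refine limitMeasure_of_preimage_eq_Ioo hr measurableSet_Ioo hβ.1.le hβα.le hα.2.le ?_
  ext φ
  constructor
  · rintro ⟨⟨h1, h2⟩, hφ⟩
    exact ⟨(hanti.lt_iff_gt hφ hβ).1 h2, (hanti.lt_iff_gt hα hφ).1 h1⟩
  · rintro ⟨h1, h2⟩
    have hφ : φ ∈ Set.Ioo 0 (π / ((r : ℝ) + 1)) := ⟨hβ.1.trans h1, h2.trans hα.2⟩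
    exact ⟨⟨hanti hφ hα h2, hanti hβ hφ h1⟩, hφ⟩

theorem phase_le_phase (hr : 1 ≤ r) {α β : ℝ} (hα : 0 ≤ α) (hαβ : α ≤ β)
    (hβ : β ≤ π / ((r : ℝ) + 1)) : phase r α ≤ phase r β := by
  rw [← sub_nonneg, ← integral_phaseDeriv hr hα hαβ hβ, intervalIntegral.integral_of_le hαβ,
    integral_Ioc_eq_integral_Ioo]
  exact setIntegral_nonneg measurableSet_Ioo fun φ hφ =>
    (phaseDeriv_pos hr ⟨hα.trans_lt hφ.1, hφ.2.trans_le hβ⟩).le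

end LimitMeasure

/-! ### The rescaled polynomials -/

theorem coeff_rescaled {r : ℕ} (ν : Fin r → ℕ) (n : ℕ) (c : ℝ) (k : ℕ) :
    ((∑ k ∈ Finset.range (n + 1),
      Polynomial.C ((-1 : ℝ) ^ k * (n.choose k : ℝ) / ∏ j, ((k + ν j).factorial : ℝ)) *
        Polynomial.X ^ k).comp (Polynomial.C c * Polynomial.X)).coeff k =
      (-1) ^ k * (n.choose k) * c ^ k / ∏ j, ((k + ν j).factorial : ℝ) := by
  rw [comp_C_mul_X_coeff, finsetSum_coeff]
  simp only [coeff_C_mul, coeff_X_pow, mul_ite, mul_one, mul_zero]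
  rw [Finset.sum_ite_eq]
  split_ifs with hk
  · ring
  · rw [Nat.choose_eq_zero_of_lt (by simpa using hk)]
    simp

theorem coeff_recursion {r : ℕ} (ν : Fin r → ℕ) {n : ℕ} {G : ℝ[X]}
    (hG : ∀ k, G.coeff k =
      (-1) ^ k * (n.choose k) * ((n : ℝ) ^ r) ^ k / ∏ j, ((k + ν j).factorial : ℝ)) {k : ℕ}
    (hk : k < n) :
    ((k : ℝ) + 1) * ((List.ofFn ν).map fun ν : ℕ => (k : ℝ) + 1 + ν).prod * G.coeff (k + 1) =
      (n : ℝ) ^ (List.ofFn ν).length * ((k : ℝ) - n) * G.coeff k := by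
  have hch : (n.choose (k + 1) : ℝ) * (k + 1) = n.choose k * (n - k) := by
    have := congrArg (Nat.cast (R := ℝ)) (Nat.choose_succ_right_eq n k)
    push_cast [hk.le] at this
    exact this
  have hfac : ∏ j, ((k + 1 + ν j).factorial : ℝ) =
      (∏ j, ((k : ℝ) + 1 + ν j)) * ∏ j, ((k + ν j).factorial : ℝ) := by
    rw [← Finset.prod_mul_distrib]
    refine Finset.prod_congr rfl fun j _ => ?_
    rw [show k + 1 + ν j = k + ν j + 1 by ring, Nat.factorial_succ]
    push_cast
    ring
  have h1 : ∏ j, ((k : ℝ) + 1 + ν j) ≠ 0 :=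
    Finset.prod_ne_zero_iff.2 fun j _ => by positivity
  have h2 : ∏ j, ((k + ν j).factorial : ℝ) ≠ 0 :=
    Finset.prod_ne_zero_iff.2 fun j _ => by positivity
  rw [hG, hG, hfac, List.map_ofFn, List.prod_ofFn, List.length_ofFn]
  simp only [Function.comp_apply]
  field_simp
  linear_combination (-1 : ℝ) ^ (k + 1) * ((n : ℝ) ^ r) ^ (k + 1) * hch

theorem natDegree_of_coeff {r : ℕ} (ν : Fin r → ℕ) {n : ℕ} (hn : n ≠ 0) {G : ℝ[X]}
    (hG : ∀ k, G.coeff k =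
      (-1) ^ k * (n.choose k) * ((n : ℝ) ^ r) ^ k / ∏ j, ((k + ν j).factorial : ℝ)) :
    G.natDegree = n := by
  refine natDegree_eq_of_le_of_coeff_ne_zero (natDegree_le_iff_coeff_eq_zero.2 fun k hk => ?_) ?_
  · rw [hG, Nat.choose_eq_zero_of_lt hk]
    simp
  · rw [hG, Nat.choose_self]
    have h : ∏ j, ((n + ν j).factorial : ℝ) ≠ 0 :=
      Finset.prod_ne_zero_iff.2 fun j _ => by positivity
    have hn' : (n : ℝ) ≠ 0 := by exact_mod_cast hn
    simp [h, hn']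

theorem tendsto_moments {r : ℕ} (hr : 1 ≤ r) (ν : Fin r → ℕ) {G : ℕ → ℝ[X]}
    (hG : ∀ n k, (G n).coeff k =
      (-1) ^ k * (n.choose k) * ((n : ℝ) ^ r) ^ k / ∏ j, ((k + ν j).factorial : ℝ)) (k : ℕ) :
    Tendsto (fun n : ℕ => (n : ℝ)⁻¹ * ((G n).roots.map (· ^ k)).sum) atTop
      (nhds (∫ x, x ^ k ∂limitMeasure r)) := by
  obtain ⟨B, hB⟩ := exists_fussCatalan_series r
  rw [integral_pow_limitMeasure_eq_coeff hr hB]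
  have h := tendsto_coeff_of_riccati (List.ofFn ν) (B := B) (by rwa [List.length_ofFn])
    (W := fun n => PowerSeries.C ((n : ℝ)⁻¹) * powerSumSeries (G n).roots)
    (fun n hn => riccati_equation hn
      (splits_of_coeff_eq_choose_div_factorial Finset.univ ν n _ _ (hG n))
      (natDegree_of_coeff ν hn (hG n)) _ fun k hk => coeff_recursion ν (hG n) hk) k
  simpa [powerSumSeries] using h

theorem tendsto_proportion_roots {r : ℕ} (hr : 1 ≤ r) (ν : Fin r → ℕ) {G : ℕ → ℝ[X]}
    (hG : ∀ n k, (G n).coeff k =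
      (-1) ^ k * (n.choose k) * ((n : ℝ) ^ r) ^ k / ∏ j, ((k + ν j).factorial : ℝ))
    {A : Set ℝ} (hA : MeasurableSet A) (hfr : limitMeasure r (frontier A) = 0) :
    Tendsto (fun n : ℕ => (((G n).roots.filter (· ∈ A)).card : ℝ) / n) atTop
      (nhds ((limitMeasure r).real A)) := by
  have hcard : ∀ n ≠ 0, (G n).roots.card = n := fun n hn => by
    rw [splits_iff_card_roots.1
      (splits_of_coeff_eq_choose_div_factorial Finset.univ ν n _ _ (hG n)),
      natDegree_of_coeff ν hn (hG n)]
  have hne : ∀ n, (G (n + 1)).roots.card ≠ 0 := fun n => by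
    rw [hcard _ n.succ_ne_zero]; exact n.succ_ne_zero
  have hprob := isProbabilityMeasure_limitMeasure hr
  let μs : ℕ → ProbabilityMeasure ℝ := fun n =>
    ⟨empiricalMeasure (G (n + 1)).roots, isProbabilityMeasure_empiricalMeasure (hne n)⟩
  have hlim : Tendsto μs atTop (nhds ⟨limitMeasure r, hprob⟩) := by
    refine tendsto_probabilityMeasure_of_moments (ae_abs_le_limitMeasure hr)
      (fun n k => integrable_empiricalMeasure (hne n) _) fun k => ?_
    have h := (tendsto_add_atTop_iff_nat 1).2 (tendsto_moments hr ν hG k)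
    refine h.congr fun n => ?_
    change _ = ∫ x, x ^ k ∂empiricalMeasure (G (n + 1)).roots
    rw [integral_empiricalMeasure, hcard _ n.succ_ne_zero]
  have hset := ProbabilityMeasure.tendsto_measure_of_null_frontier_of_tendsto' hlim hfr
  have hreal := (ENNReal.tendsto_toReal (measure_ne_top (limitMeasure r) A)).comp hset
  refine (tendsto_add_atTop_iff_nat 1).1 (hreal.congr fun n => ?_)
  change (empiricalMeasure (G (n + 1)).roots).real A = _
  rw [empiricalMeasure_real _ hA, hcard _ n.succ_ne_zero]

/-- Asymptotic proportion of zeros of `x ↦ F_n(n^r x)` lying in `(ε₁, ε₂)`. -/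
theorem stmt_10 (r : ℕ) (hr : 1 ≤ r) (ν : Fin r → ℕ)
    (F : ℕ → Polynomial ℝ)
    (hF : ∀ n, F n = ∑ k ∈ Finset.range (n + 1),
      Polynomial.C ((-1 : ℝ) ^ k * (n.choose k : ℝ) / ∏ j, ((k + ν j).factorial : ℝ)) *
        Polynomial.X ^ k)
    (ρ f : ℝ → ℝ)
    (hρ : ∀ φ, ρ φ = Real.sin (((r : ℝ) + 1) * φ) ^ (r + 1) /
      (Real.sin φ * Real.sin ((r : ℝ) * φ) ^ r))
    (hf : ∀ φ, f φ = ((r : ℝ) + 1) * φ -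
      (r : ℝ) * (Real.sin (((r : ℝ) + 1) * φ) / Real.sin ((r : ℝ) * φ)) * Real.sin φ)
    (ρinv : ℝ → ℝ)
    (hρinv : ∀ x ∈ Set.Ioo (0 : ℝ) (((r : ℝ) + 1) ^ (r + 1) / (r : ℝ) ^ r),
      ρinv x ∈ Set.Ioo 0 (π / ((r : ℝ) + 1)) ∧ ρ (ρinv x) = x)
    (ε₁ ε₂ : ℝ) (hε1 : 0 < ε₁) (hε12 : ε₁ < ε₂)
    (hε2 : ε₂ < ((r : ℝ) + 1) ^ (r + 1) / (r : ℝ) ^ r) :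
    Tendsto (fun n : ℕ =>
      ((((F n).comp (Polynomial.C ((n : ℝ) ^ r) * Polynomial.X)).roots.filter
          (fun a => ε₁ < a ∧ a < ε₂)).card : ℝ) / (n : ℝ))
      atTop (nhds ((1 / π) * f (ρinv ε₁) - (1 / π) * f (ρinv ε₂))) := by
  obtain rfl : ρ = rhoParam r := funext hρ
  obtain rfl : f = phase r := funext hf
  obtain ⟨hφ1, hρ1⟩ := hρinv ε₁ ⟨hε1, hε12.trans hε2⟩
  obtain ⟨hφ2, hρ2⟩ := hρinv ε₂ ⟨hε1.trans hε12, hε2⟩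
  have hfr : limitMeasure r (frontier (Set.Ioo ε₁ ε₂)) = 0 := by
    rw [frontier_Ioo hε12]
    exact measure_union_null (limitMeasure_singleton hr ε₁) (limitMeasure_singleton hr ε₂)
  have hlim := tendsto_proportion_roots hr ν
    (G := fun n => (F n).comp (Polynomial.C ((n : ℝ) ^ r) * Polynomial.X))
    (fun n k => by rw [hF]; exact coeff_rescaled ν n _ k) measurableSet_Ioo hfr
  have hlt : rhoParam r (ρinv ε₁) < rhoParam r (ρinv ε₂) := by rwa [hρ1, hρ2]
  have hle : phase r (ρinv ε₂) ≤ phase r (ρinv ε₁) :=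
    phase_le_phase hr hφ2.1.le (((strictAntiOn_rhoParam hr).lt_iff_gt hφ1 hφ2).1 hlt).le hφ1.2.le
  have hval : (limitMeasure r).real (Set.Ioo ε₁ ε₂) =
      (1 / π) * phase r (ρinv ε₁) - (1 / π) * phase r (ρinv ε₂) := by
    have h := limitMeasure_Ioo hr hφ1 hφ2 hlt
    rw [hρ1, hρ2] at h
    rw [Measure.real, h, ENNReal.toReal_ofReal (div_nonneg (sub_nonneg.2 hle) pi_pos.le)]
    ring
  rw [← hval]
  convert hlim using 6
  rfl
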